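/- Let f(𝐱) = F₁(𝐱') + ωF₂(𝐱') ∈ 𝒢𝒮ℛ(Ω_D). Then for every integer k ≥ 1: Δ_𝐱^k f(𝐱) = C_q(k) ( ((1/r)∂_r)^k F₁(𝐱') + ω (∂_r (1/r))^k F₂(𝐱') ), where C_q(k) = (q−1)(q−3)⋯(q−2k+1), and where the values of ((1/r)∂_r)^k F₁ and (∂_r(1/r))^k F₂ at points (𝐱_p, 0) ∈ D are interpreted as the limits as r → 0, which exist. -/

import Mathlib

/-!
Common framework for generalized partial-slice monogenic functions
(Xu–Sabadini, "On the Fueter-Sce theorem for generalized partial-slice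
monogenic functions").

The real Clifford algebra `ℝ_{p+q}` is formalized as the Mathlib Clifford
algebra of the negative-definite quadratic form on `ℝ^{p+q}`; since Mathlib
provides no canonical norm on it, all analytic statements are phrased for an
arbitrary normed real algebra `A` together with an `ℝ`-algebra isomorphism
`ξ : A ≃ₐ[ℝ] Cl (p+q)`.  A point of `ℝ^{p+q+1}` is a pair
`(𝐱_p, 𝐱_q) : (Fin (p+1) → ℝ) × EuclideanSpace ℝ (Fin q)`, and a point of a
slice `ℝ^{p+2}` is a pair `(𝐱_p, r)`.
-/

noncomputable section

open Filter Topology MeasureTheory Metric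
open scoped Nat RealInnerProductSpace

namespace GPS

/-- The negative definite quadratic form `-(x₁² + ⋯ + xₙ²)` on `ℝⁿ`. -/
def Qe (n : ℕ) : QuadraticForm ℝ (Fin n → ℝ) :=
  QuadraticMap.weightedSumSquares ℝ (fun _ : Fin n => (-1 : ℝ))

/-- The real Clifford algebra `ℝ_n`. -/
abbrev Cl (n : ℕ) : Type := CliffordAlgebra (Qe n)

/-- The generators `e_1, …, e_n` of `ℝ_n` (indexed by `Fin n`). -/
def e (n : ℕ) (i : Fin n) : Cl n := CliffordAlgebra.ι (Qe n) (Pi.single i 1)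

variable (p q : ℕ)

/-- `ℝ^{p+1}`, the "slice-axis" space. -/
abbrev Vp : Type := Fin (p + 1) → ℝ

/-- `ℝ^q`. -/
abbrev Vq : Type := EuclideanSpace ℝ (Fin q)

/-- `ℝ^{p+q+1} = ℝ^{p+1} ⊕ ℝ^q`. -/
abbrev V : Type := Vp p × Vq q

/-- `ℝ^{p+2}`, the parameter space `(𝐱_p, r)` of a slice. -/
abbrev Sl : Type := Vp p × ℝ

/-- The sphere `𝕊` of unit 1-vectors, described by their coordinate vectors
`(x_{p+1}, …, x_{p+q}) ∈ ℝ^q` with `∑ x_i² = 1`. -/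
def S : Set (Vq q) := {v | ∑ j, v j ^ 2 = 1}

/-- The point `𝐱_p + r ω` of `ℝ^{p+q+1}`. -/
def spt (v : Vq q) (z : Sl p) : V p q := (z.1, z.2 • v)

/-- The (parameterized) slice `Ω_ω` of a set `Ω ⊆ ℝ^{p+q+1}`. -/
def sliceSet (Ω : Set (V p q)) (v : Vq q) : Set (Sl p) := {z | spt p q v z ∈ Ω}

/-- `Ω₀* = {𝐱_p + 𝐱_q : 𝐱_p ∈ Ω₀, 𝐱_q ∈ ℝ^q}`. -/
def star0 (Ω₀ : Set (Vp p)) : Set (V p q) := {z | z.1 ∈ Ω₀}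

/-- The p-symmetric completion `Ω_D` of a set `D ⊆ ℝ^{p+2}`. -/
def completion (D : Set (Sl p)) : Set (V p q) :=
  {x | ∃ z ∈ D, ∃ v ∈ S q, x = spt p q v z}

/-- `D` is invariant under the reflection of the `(p+2)`-th variable. -/
def ReflInv (D : Set (Sl p)) : Prop := ∀ z ∈ D, ((z.1, -z.2) : Sl p) ∈ D

/-- A domain: a nonempty open connected set. -/
def IsDomain {E : Type*} [TopologicalSpace E] (s : Set E) : Prop :=
  IsOpen s ∧ IsConnected s

/-- A slice domain. -/
def IsSliceDomain (Ω : Set (V p q)) : Prop :=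
  IsDomain Ω ∧ (∃ x : Vp p, ((x, 0) : V p q) ∈ Ω) ∧
    ∀ v ∈ S q, IsDomain (sliceSet p q Ω v)

/-- Partial symmetry with respect to `ℝ^{p+1}`. -/
def IsPSymmetric (Ω : Set (V p q)) : Prop :=
  ∀ (x : Vp p) (r : ℝ), ∀ v ∈ S q, ∀ w ∈ S q,
    ((x, r • v) : V p q) ∈ Ω → ((x, r • w) : V p q) ∈ Ω

/-- A `d`-dimensional smooth submanifold of a real normed space. -/
def IsSmoothSubmanifoldDim {E : Type*} [NormedAddCommGroup E] [NormedSpace ℝ E]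
    (d : ℕ) (M : Set E) : Prop :=
  ∀ x ∈ M, ∃ U : Set E, IsOpen U ∧ x ∈ U ∧
    ∃ (ψ : (Fin d → ℝ) → E) (W : Set (Fin d → ℝ)), IsOpen W ∧
      ContDiffOn ℝ (⊤ : ℕ∞) ψ W ∧ Set.InjOn ψ W ∧
      (∀ y ∈ W, Function.Injective (fderivWithin ℝ ψ W y)) ∧
      M ∩ U = ψ '' W

variable {A : Type*} [NormedRing A] [NormedAlgebra ℝ A] (ξ : A ≃ₐ[ℝ] Cl (p + q))

/-- The generators `e_1, …, e_{p+q}` inside `A`. -/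
def gen (i : Fin (p + q)) : A := ξ.symm (e (p + q) i)

/-- The generators `e_{p+1}, …, e_{p+q}` (the "q-part"). -/
def eQ (j : Fin q) : A := gen p q ξ ⟨p + (j : ℕ), by have := j.isLt; omega⟩

/-- The generators `e_1, …, e_p` (the "p-part", without `e_0 = 1`). -/
def eP (i : Fin p) : A := gen p q ξ ⟨(i : ℕ), by have := i.isLt; omega⟩

/-- `e_0 = 1, e_1, …, e_p`: the paravector basis of `ℝ^{p+1}` inside `A`. -/
def εp (i : Fin (p + 1)) : A :=
  if h : (i : ℕ) = 0 then 1 else gen p q ξ ⟨(i : ℕ) - 1, by have := i.isLt; omega⟩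

/-- The 1-vector `∑ x_i e_{p+i} ∈ A` corresponding to `𝐱_q ∈ ℝ^q`;
for a unit `v` this is the imaginary unit `ω ∈ 𝕊`. -/
def ωCl (v : Vq q) : A := ∑ j, v j • eQ p q ξ j

/-- The paravector `x_0 + x_1 e_1 + ⋯ + x_p e_p ∈ A` of `𝐱_p ∈ ℝ^{p+1}`. -/
def clP (x : Vp p) : A := ∑ i, x i • εp p q ξ i

/-- The paravector of `𝐱 ∈ ℝ^{p+q+1}` in `A`. -/
def toCl (z : V p q) : A := clP p q ξ z.1 + ωCl p q ξ z.2

section SliceOperators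

variable {F' : Type*} [NormedAddCommGroup F'] [NormedSpace ℝ F']

/-- `∂_{x_i}` on functions on `ℝ^{p+2}`. -/
def pdSl (i : Fin (p + 1)) (F : Sl p → F') : Sl p → F' :=
  fun z => fderiv ℝ F z (Pi.single i 1, 0)

/-- `∂_r` on functions on `ℝ^{p+2}`. -/
def pdr (F : Sl p → F') : Sl p → F' := fun z => fderiv ℝ F z (0, 1)

/-- `∂_{x_i}` (first factor) on functions on `ℝ^{p+q+1}`. -/
def pdV1 (i : Fin (p + 1)) (f : V p q → F') : V p q → F' :=
  fun z => fderiv ℝ f z ((Pi.single i 1 : Vp p), 0)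

/-- `∂_{x_{p+j}}` (second factor) on functions on `ℝ^{p+q+1}`. -/
def pdV2 (j : Fin q) (f : V p q → F') : V p q → F' :=
  fun z => fderiv ℝ f z (0, EuclideanSpace.single j 1)

/-- `∂_{x_i}` on functions on `ℝ^{p+1}`. -/
def pdP (i : Fin (p + 1)) (g : Vp p → F') : Vp p → F' :=
  fun x => fderiv ℝ g x (Pi.single i 1)

/-- The Laplacian `Δ_{𝐱'} = Δ_{𝐱_p} + ∂_r²` on `ℝ^{p+2}`. -/
def LapSl (F : Sl p → F') : Sl p → F' :=
  fun z => ∑ i, pdSl p (i := i) (pdSl p i F) z + pdr p (pdr p F) z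

/-- The Laplacian `Δ_𝐱` on `ℝ^{p+q+1}`. -/
def LapV (f : V p q → F') : V p q → F' :=
  fun z => ∑ i, pdV1 p q i (pdV1 p q i f) z + ∑ j, pdV2 p q j (pdV2 p q j f) z

/-- The Laplacian `Δ_{𝐱_p}` on `ℝ^{p+1}`. -/
def LapP (g : Vp p → F') : Vp p → F' :=
  fun x => ∑ i, pdP p i (pdP p i g) x

end SliceOperators

/-- The generalized Cauchy–Riemann operator `D_{𝐱_p} = ∑_{i=0}^p e_i ∂_{x_i}`
on slice functions. -/
def DP (F : Sl p → A) : Sl p → A :=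
  fun z => ∑ i, εp p q ξ i * pdSl p i F z

/-- The conjugated operator `D̄_{𝐱_p} = ∂_{x_0} - ∑_{i=1}^p e_i ∂_{x_i}`. -/
def DPbar (F : Sl p → A) : Sl p → A :=
  fun z => pdSl p 0 F z - ∑ i : Fin p, eP p q ξ i * pdSl p i.succ F z

/-- The generalized Cauchy–Riemann (Dirac) operator `D_𝐱` on `ℝ^{p+q+1}`. -/
def DV (f : V p q → A) : V p q → A :=
  fun z => ∑ i, εp p q ξ i * pdV1 p q i f z + ∑ j, eQ p q ξ j * pdV2 p q j f z

/-- `D_{𝐱_p} = ∑_{i=0}^p e_i ∂_{x_i}` on functions on `ℝ^{p+1}`. -/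
def DPfun (g : Vp p → A) : Vp p → A :=
  fun x => ∑ i, εp p q ξ i * pdP p i g x

/-- The slice operator `D_ω = D_{𝐱_p} + ω ∂_r`, expressed on `ℝ^{p+q+1} ∖ ℝ^{p+1}`
(at `𝐱_q = 0` the radial part is junk `0`). -/
def Dslice (f : V p q → A) : V p q → A :=
  fun z => ∑ i, εp p q ξ i * pdV1 p q i f z
    + ωCl p q ξ (‖z.2‖⁻¹ • z.2) * fderiv ℝ f z (0, ‖z.2‖⁻¹ • z.2)

/-- The spherical Dirac operator `Γ = -∑_{i<j} e_i e_j L_{ij}` on the `ℝ^q` variables. -/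
def sphericalDirac (f : V p q → A) : V p q → A :=
  fun z => - ∑ i : Fin q, ∑ j : Fin q,
    if (i : ℕ) < (j : ℕ) then
      eQ p q ξ i * eQ p q ξ j *
        (z.2 i • pdV2 p q j f z - z.2 j • pdV2 p q i f z)
    else 0

/-- `f` is left generalized partial-slice monogenic of type `(p,q)` on `Ω`. -/
def GSMOn (Ω : Set (V p q)) (f : V p q → A) : Prop :=
  ∀ v ∈ S q,
    ContDiffOn ℝ 1 (fun z => f (spt p q v z)) (sliceSet p q Ω v) ∧
    ∀ z ∈ sliceSet p q Ω v,
      DP p q ξ (fun w => f (spt p q v w)) z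
        + ωCl p q ξ v * pdr p (fun w => f (spt p q v w)) z = 0

/-- `f` is (left) monogenic on `Ω`. -/
def MonogenicOn (Ω : Set (V p q)) (f : V p q → A) : Prop :=
  ContDiffOn ℝ 1 f Ω ∧ ∀ z ∈ Ω, DV p q ξ f z = 0

/-- `f` is the generalized partial-slice function on `Ω_D` with components `F1, F2`
(an even–odd pair in the last variable). -/
def IsGPSlice (D : Set (Sl p)) (f : V p q → A) (F1 F2 : Sl p → A) : Prop :=
  (∀ z ∈ D, F1 (z.1, -z.2) = F1 z ∧ F2 (z.1, -z.2) = -F2 z) ∧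
  ∀ z ∈ D, ∀ v ∈ S q, f (spt p q v z) = F1 z + ωCl p q ξ v * F2 z

/-- The generalized Cauchy–Riemann system (2.6) for the pair `(F1, F2)`. -/
def CRSystem (D : Set (Sl p)) (F1 F2 : Sl p → A) : Prop :=
  ∀ z ∈ D, DP p q ξ F1 z - pdr p F2 z = 0 ∧ DPbar p q ξ F2 z + pdr p F1 z = 0

/-- `f ∈ 𝒢𝒮ℛ(Ω_D)` with the given components. -/
def GSROnWith (D : Set (Sl p)) (f : V p q → A) (F1 F2 : Sl p → A) : Prop :=
  IsGPSlice p q ξ D f F1 F2 ∧ ContDiffOn ℝ 1 F1 D ∧ ContDiffOn ℝ 1 F2 D ∧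
    CRSystem p q ξ D F1 F2

/-- `f ∈ 𝒢𝒮ℛ(Ω_D)`. -/
def GSROn (D : Set (Sl p)) (f : V p q → A) : Prop :=
  ∃ F1 F2, GSROnWith p q ξ D f F1 F2

/-- Iterates `((1/r) ∂_r)^k F`. -/
def AIter (F : Sl p → A) : ℕ → Sl p → A
  | 0 => F
  | k + 1 => fun z => z.2⁻¹ • pdr p (AIter F k) z

/-- Iterates `(∂_r (1/r))^k F`. -/
def BIter (F : Sl p → A) : ℕ → Sl p → A
  | 0 => F
  | k + 1 => fun z => fderiv ℝ (fun w : Sl p => w.2⁻¹ • BIter F k w) z (0, 1)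

/-- `C_q(k) = (q-1)(q-3)⋯(q-2k+1)`. -/
def Cq (k : ℕ) : ℝ := ∏ j ∈ Finset.range k, ((q : ℝ) - (2 * (j : ℝ) + 1))

/-- The Fueter–Sce map `τ_q = (1/(q-1)!!) Δ^{(q-1)/2}` (for odd `q`). -/
def tauq (f : V p q → A) : V p q → A :=
  fun z => (((q - 1)‼ : ℝ))⁻¹ • (LapV p q)^[(q - 1) / 2] f z

/-- `(𝐱_q D_{𝐱_p})^k`, for a fixed Clifford element `u` in place of `𝐱_q`. -/
def uDpow (u : A) : ℕ → (Vp p → A) → Vp p → A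
  | 0 => fun g => g
  | k + 1 => fun g x => u * DPfun p q ξ (uDpow u k g) x

/-- The `k`-th term of the slice Cauchy–Kovalevskaya extension series. -/
def ckTerm (f₀ : Vp p → A) (k : ℕ) (z : V p q) : A :=
  ((k ! : ℝ))⁻¹ • uDpow p q ξ (ωCl p q ξ z.2) k f₀ z.1

/-- The slice Cauchy–Kovalevskaya extension `CK[f₀]`. -/
def CKext (f₀ : Vp p → A) (z : V p q) : A := ∑' k, ckTerm p q ξ f₀ k z

/-- The `k`-th term of the CK-extension for a fixed direction `w`. -/
def ckDirTerm (w : Vq q) (f₀ : Vp p → A) (k : ℕ) (z : V p q) : A :=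
  ((⟪w, z.2⟫) ^ k / (k ! : ℝ)) • uDpow p q ξ (ωCl p q ξ w) k f₀ z.1

/-- The CK-extension for a fixed direction `w ∈ 𝕊`. -/
def CKdir (w : Vq q) (f₀ : Vp p → A) (z : V p q) : A :=
  ∑' k, ckDirTerm p q ξ w f₀ k z

/-- The coefficients of the generalized CK-extension:
`f_{2k} = (Γ(q/2) / (2^{2k} k! Γ(k+q/2))) Δ^k f₀` and
`f_{2k+1} = (Γ(q/2) / (2^{2k+1} k! Γ(k+q/2+1))) D Δ^k f₀`. -/
def gckCoeff (f₀ : Vp p → A) (k : ℕ) : Vp p → A :=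
  if k % 2 = 0 then
    fun x => (Real.Gamma ((q : ℝ) / 2) /
        (2 ^ k * ((k / 2)! : ℝ) * Real.Gamma (((k / 2 : ℕ) : ℝ) + (q : ℝ) / 2))) •
      (LapP p)^[k / 2] f₀ x
  else
    fun x => (Real.Gamma ((q : ℝ) / 2) /
        (2 ^ k * ((k / 2)! : ℝ) * Real.Gamma (((k / 2 : ℕ) : ℝ) + (q : ℝ) / 2 + 1))) •
      DPfun p q ξ ((LapP p)^[k / 2] f₀) x

/-- The `k`-th term `𝐱_q^k f_k(𝐱_p)` of the generalized CK-extension series. -/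
def gckTerm (f₀ : Vp p → A) (k : ℕ) (z : V p q) : A :=
  (ωCl p q ξ z.2) ^ k * gckCoeff p q ξ f₀ k z.1

/-- The generalized CK-extension `GCK[f₀]`. -/
def GCKext (f₀ : Vp p → A) (z : V p q) : A := ∑' k, gckTerm p q ξ f₀ k z

/-- The Radon transform `R[f](𝐱_p, r, ω) = ∫_{⟨𝐱_q,ω⟩=r} f(𝐱_p, 𝐱_q) dσ(𝐱_q)`. -/
def radon (f : V p q → A) (x : Vp p) (r : ℝ) (w : Vq q) : A :=
  ∫ u : ((Submodule.span ℝ {w})ᗮ : Submodule ℝ (Vq q)),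
    f (x, r • w + (u : Vq q))

/-- The (suitably normalized) surface measure on the unit sphere of `ℝ^q`. -/
def sphMeasure : Measure (sphere (0 : Vq q) 1) := volume.toSphere

/-- The dual Radon transform
`Ř[f](𝐱_p, 𝐱_q) = (1/A_q) ∫_𝕊 f(𝐱_p, ⟨𝐱_q, η⟩ η) dS(η)` (a spherical average). -/
def dualRadon (f : V p q → A) (z : V p q) : A :=
  ⨍ w : sphere (0 : Vq q) 1,
    f (z.1, (⟪((w : Vq q)), z.2⟫) • (w : Vq q)) ∂(sphMeasure q)

end GPS

open GPS

open scoped ContDiff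

namespace GPS

section Weyl

variable {E : Type*} [NormedAddCommGroup E] [NormedSpace ℝ E]
  {G : Type*} [NormedAddCommGroup G] [NormedSpace ℝ G]

omit [NormedSpace ℝ E] in
/-- A scalar continuous function with support in an open set `U`, times a function
continuous on `U`, is continuous. -/
lemma continuous_smul_of_tsupport_subset {U : Set E} (hU : IsOpen U) {η : E → ℝ} {F : E → G}
    (hη : Continuous η) (hsupp : tsupport η ⊆ U) (hF : ContinuousOn F U) :
    Continuous (fun z => η z • F z) := by
  apply continuous_of_tsupport
  intro x hx
  have hx' : x ∈ tsupport η := tsupport_smul_subset_left η F hx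
  exact hη.continuousAt.smul (hF.continuousAt (hU.mem_nhds (hsupp hx')))

variable [FiniteDimensional ℝ E] [MeasurableSpace E] [BorelSpace E]
  (μ : Measure E) [μ.IsAddHaarMeasure]

omit [NormedSpace ℝ E] [FiniteDimensional ℝ E] in
lemma integrable_smul_of_tsupport_subset {U : Set E} (hU : IsOpen U) {η : E → ℝ} {F : E → G}
    (hη : Continuous η) (hc : HasCompactSupport η) (hsupp : tsupport η ⊆ U)
    (hF : ContinuousOn F U) : Integrable (fun z => η z • F z) μ :=
  (continuous_smul_of_tsupport_subset hU hη hsupp hF).integrable_of_hasCompactSupport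
    hc.smul_right

/-- Integration by parts against a test function supported in an open set. -/
lemma integral_smul_fderiv_of_tsupport_subset {U : Set E} (hU : IsOpen U) {η : E → ℝ} {F : E → G}
    (hη : ContDiff ℝ 1 η) (hc : HasCompactSupport η) (hsupp : tsupport η ⊆ U)
    (hF : ContDiffOn ℝ 1 F U) (v : E) :
    ∫ z, η z • fderiv ℝ F z v ∂μ = -∫ z, fderiv ℝ η z v • F z ∂μ := by
  have hη' : Continuous fun z => fderiv ℝ η z v :=
    (hη.continuous_fderiv one_ne_zero).clm_apply continuous_const
  have hc' : HasCompactSupport fun z => fderiv ℝ η z v :=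
    hc.mono' (subset_tsupport _ |>.trans (tsupport_fderiv_apply_subset ℝ v))
  have hsupp' : tsupport (fun z => fderiv ℝ η z v) ⊆ U :=
    (tsupport_fderiv_apply_subset ℝ v).trans hsupp
  have hF' : ContinuousOn (fun z => fderiv ℝ F z v) U :=
    (hF.continuousOn_fderiv_of_isOpen hU le_rfl).clm_apply continuousOn_const
  refine integral_bilinear_fderiv_right_eq_neg_left_of_integrable
    (B := ContinuousLinearMap.lsmul ℝ ℝ) ?_ ?_ ?_ ?_ ?_
  · exact integrable_smul_of_tsupport_subset μ hU hη' hc' hsupp' hF.continuousOn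
  · exact integrable_smul_of_tsupport_subset μ hU hη.continuous hc hsupp hF'
  · exact integrable_smul_of_tsupport_subset μ hU hη.continuous hc hsupp hF.continuousOn
  · exact fun x _ => hη.differentiable one_ne_zero x
  · exact fun x hx => (hF.differentiableOn one_ne_zero).differentiableAt (hU.mem_nhds (hsupp hx))

/-- A smooth antitone profile, vanishing beyond `c ^ 2`, which is not locally constant. -/
lemma exists_radial_profile {c : ℝ} (hc : 0 < c) :
    ∃ Φ : ℝ → ℝ, ContDiff ℝ ∞ Φ ∧ (∀ s, c ^ 2 ≤ s → Φ s = 0) ∧ (∀ s, deriv Φ s ≤ 0) ∧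
      ∃ s, 0 < s ∧ deriv Φ s ≠ 0 := by
  have hc2 : 0 < c ^ 2 := by positivity
  let Φ : ℝ → ℝ := fun s => Real.smoothTransition (1 - s / c ^ 2)
  have hΦ : ContDiff ℝ ∞ Φ := Real.smoothTransition.contDiff.comp (by fun_prop)
  have hanti : Antitone Φ := fun a b hab => Real.smoothTransition.monotone (by gcongr)
  refine ⟨Φ, hΦ, fun s hs => Real.smoothTransition.zero_of_nonpos ?_,
    fun s => hanti.deriv_nonpos, ?_⟩
  · rw [sub_nonpos]; exact (one_le_div hc2).2 hs
  · obtain ⟨s, hs, hs'⟩ := exists_deriv_eq_slope Φ hc2 hΦ.continuous.continuousOn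
      (hΦ.differentiable (by simp)).differentiableOn
    refine ⟨s, hs.1, ?_⟩
    rw [hs']
    have h0 : Φ 0 = 1 := by simp [Φ]
    have h1 : Φ (c ^ 2) = 0 := by simp [Φ, hc2.ne']
    rw [h0, h1]
    have := hc2.ne'
    simp [this]

end Weyl

section Weyl

variable {E : Type*} [NormedAddCommGroup E] [NormedSpace ℝ E]
  {G : Type*} [NormedAddCommGroup G] [NormedSpace ℝ G]

variable {ι : Type*} [Fintype ι] (b : Module.Basis ι ℝ E)

/-- The sum of the squares of the coordinates in a basis. -/
def sqCoord (y : E) : ℝ := ∑ i, (b.repr y i) ^ 2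

lemma norm_le_of_sqCoord_le {c : ℝ} (hc : 0 ≤ c) {y : E} (hy : sqCoord b y ≤ c ^ 2) :
    ‖y‖ ≤ c * ∑ i, ‖b i‖ := by
  rw [← b.sum_repr y, Finset.mul_sum]
  refine (norm_sum_le _ _).trans (Finset.sum_le_sum fun i _ => ?_)
  rw [norm_smul]
  gcongr
  refine abs_le_of_sq_le_sq ?_ hc
  exact (Finset.single_le_sum (f := fun i => (b.repr y i) ^ 2)
    (fun i _ => sq_nonneg _) (Finset.mem_univ i)).trans hy

variable [FiniteDimensional ℝ E]

omit [Fintype ι] in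
lemma contDiff_repr (i : ι) : ContDiff ℝ ∞ (fun y => b.repr y i) :=
  (LinearMap.toContinuousLinearMap (b.coord i)).contDiff

lemma contDiff_sqCoord : ContDiff ℝ ∞ (sqCoord b) :=
  ContDiff.sum fun i _ => (contDiff_repr b i).pow 2

lemma fderiv_sqCoord_basis [DecidableEq ι] (y : E) (i : ι) :
    fderiv ℝ (sqCoord b) y (b i) = 2 * b.repr y i := by
  have h : HasFDerivAt (sqCoord b)
      (∑ j, (2 * b.repr y j) • LinearMap.toContinuousLinearMap (b.coord j)) y := by
    refine HasFDerivAt.fun_sum fun j _ => ?_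
    have := (LinearMap.toContinuousLinearMap (b.coord j)).hasFDerivAt (x := y) |>.pow 2
    simpa using this
  rw [h.fderiv]
  simp [Finsupp.single_apply]

omit [FiniteDimensional ℝ E] in
lemma exists_sqCoord_le_imp_norm_lt {ρ : ℝ} (hρ : 0 < ρ) :
    ∃ c : ℝ, 0 < c ∧ ∀ y : E, sqCoord b y ≤ c ^ 2 → ‖y‖ < ρ := by
  have hS : 0 ≤ ∑ i, ‖b i‖ := Finset.sum_nonneg fun i _ => norm_nonneg _
  refine ⟨ρ / (1 + ∑ i, ‖b i‖), by positivity, fun y hy => ?_⟩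
  refine (norm_le_of_sqCoord_le b (by positivity) hy).trans_lt ?_
  rw [div_mul_eq_mul_div, div_lt_iff₀ (by positivity)]
  nlinarith

/-- A radial test function `Ψ` supported in a small ball, together with `ψ` such that
`∂_i Ψ = 2 y_i ψ` and `∫ ψ ≠ 0`. -/
lemma exists_radial_test [Nonempty ι] [DecidableEq ι] [MeasurableSpace E] [BorelSpace E]
    (μ : Measure E) [μ.IsAddHaarMeasure] {ρ : ℝ} (hρ : 0 < ρ) :
    ∃ Ψ ψ : E → ℝ, ContDiff ℝ ∞ Ψ ∧ ContDiff ℝ ∞ ψ ∧ tsupport Ψ ⊆ closedBall 0 ρ ∧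
      tsupport ψ ⊆ closedBall 0 ρ ∧ (∀ y i, fderiv ℝ Ψ y (b i) = 2 * b.repr y i * ψ y) ∧
      (∀ y, ψ (-y) = ψ y) ∧ ∫ y, ψ y ∂μ ≠ 0 := by
  obtain ⟨c, hc, hcρ⟩ := exists_sqCoord_le_imp_norm_lt b hρ
  obtain ⟨Φ, hΦ, hΦ0, hΦneg, s, hs, hΦs⟩ := exists_radial_profile hc
  have hdΦ : ContDiff ℝ ∞ (deriv Φ) := ((contDiff_infty_iff_deriv).1 hΦ).2
  have hdΦ0 : ∀ s, c ^ 2 < s → deriv Φ s = 0 := fun s hs => by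
    have : Φ =ᶠ[𝓝 s] fun _ => 0 := by
      filter_upwards [lt_mem_nhds hs] with t ht using hΦ0 t ht.le
    rw [this.deriv_eq]; simp
  have hsupp : ∀ g : ℝ → ℝ, (∀ s, c ^ 2 < s → g s = 0) →
      tsupport (fun y => g (sqCoord b y)) ⊆ closedBall 0 ρ := by
    intro g hg
    refine closure_minimal (fun y hy => ?_) isClosed_closedBall
    rw [mem_closedBall_zero_iff]
    by_contra hcon
    refine hy (hg _ ?_)
    by_contra hle
    exact hcon (hcρ y (not_lt.1 hle)).le
  have hψ : ContDiff ℝ ∞ (fun y => deriv Φ (sqCoord b y)) := hdΦ.comp (contDiff_sqCoord b)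
  refine ⟨fun y => Φ (sqCoord b y), fun y => deriv Φ (sqCoord b y),
    hΦ.comp (contDiff_sqCoord b), hψ,
    hsupp _ fun s hs => hΦ0 s hs.le, hsupp _ hdΦ0, fun y i => ?_, fun y => ?_, ?_⟩
  · have h1 := (hΦ.differentiable (by simp) (sqCoord b y)).hasDerivAt.comp_hasFDerivAt y
      ((contDiff_sqCoord b).differentiable (by simp) y).hasFDerivAt
    have h2 : fderiv ℝ (fun y => Φ (sqCoord b y)) y
      = deriv Φ (sqCoord b y) • fderiv ℝ (sqCoord b) y := h1.fderiv
    rw [h2, smul_apply, fderiv_sqCoord_basis, smul_eq_mul, mul_comm]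
  · simp [sqCoord]
  · obtain ⟨i⟩ := ‹Nonempty ι›
    have hpos : 0 < ∫ y, -deriv Φ (sqCoord b y) ∂μ := by
      refine Continuous.integral_pos_of_hasCompactSupport_nonneg_nonzero
        (x := √s • b i) hψ.continuous.neg ?_ (fun y => by simpa using hΦneg _) ?_
      · exact HasCompactSupport.of_support_subset_isCompact (isCompact_closedBall 0 ρ)
          ((subset_tsupport _).trans (hsupp (fun s => -deriv Φ s) fun s hs => by simp [hdΦ0 s hs]))
      · have : sqCoord b (√s • b i) = s := by
          simp [sqCoord, Finsupp.single_apply, ite_pow, Real.sq_sqrt hs.le]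
        simpa [this] using hΦs
    rw [integral_neg] at hpos
    exact fun h => by simp [h] at hpos

end Weyl

section Weyl

variable {E : Type*} [NormedAddCommGroup E] [NormedSpace ℝ E]
  {G : Type*} [NormedAddCommGroup G] [NormedSpace ℝ G]

variable {ι : Type*} [Fintype ι] (b : Module.Basis ι ℝ E)

variable [FiniteDimensional ℝ E] [MeasurableSpace E] [BorelSpace E]
    (μ : Measure E) [μ.IsAddHaarMeasure]

/-- The average of `F` against a dilated test function is differentiable in the dilation
parameter. -/
lemma hasDerivAt_integral_dilate {F : E → G} (hF : ContDiff ℝ 1 F) (hFc : HasCompactSupport F)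
    {ψ : E → ℝ} (hψ : Continuous ψ) (hψc : HasCompactSupport ψ) (z : E) (δ : ℝ) :
    HasDerivAt (fun δ : ℝ => ∫ y, ψ y • F (z - δ • y) ∂μ)
      (∫ y, ψ y • fderiv ℝ F (z - δ • y) (-y) ∂μ) δ := by
  have hF' := hF.continuous_fderiv one_ne_zero
  obtain ⟨M, hM⟩ := (hFc.fderiv (𝕜 := ℝ)).exists_bound_of_continuous hF'
  refine (hasDerivAt_integral_of_dominated_loc_of_deriv_le (s := Set.univ)
    (F := fun (δ : ℝ) y => ψ y • F (z - δ • y))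
    (F' := fun (δ : ℝ) y => ψ y • fderiv ℝ F (z - δ • y) (-y))
    (bound := fun y => ‖ψ y‖ * (M * ‖y‖)) univ_mem ?_ ?_ ?_ ?_ ?_ ?_).2
  · refine Eventually.of_forall fun δ => Continuous.aestronglyMeasurable ?_
    have := hF.continuous; fun_prop
  · refine Continuous.integrable_of_hasCompactSupport ?_ hψc.smul_right
    have := hF.continuous; fun_prop
  · exact Continuous.aestronglyMeasurable (by fun_prop)
  · refine Eventually.of_forall fun y δ _ => ?_
    rw [norm_smul]
    gcongr
    refine (ContinuousLinearMap.le_opNorm _ _).trans ?_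
    rw [norm_neg]
    gcongr
    exact hM _
  · exact Continuous.integrable_of_hasCompactSupport (by fun_prop) hψc.norm.mul_right
  · refine Eventually.of_forall fun y δ _ => ?_
    have h1 : HasDerivAt (fun δ : ℝ => z - δ • y) (-y) δ := by
      simpa using ((hasDerivAt_id δ).smul_const y).const_sub z
    exact ((hF.differentiable one_ne_zero _).hasFDerivAt.comp_hasDerivAt δ h1).const_smul (ψ y)

/-- Mean value property: weakly harmonic functions reproduce under radial averages. -/
lemma integral_dilate_deriv_eq_zero {F : E → G} (hF : ContDiff ℝ 1 F)
    {U : Set E} {ρ : ℝ}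
    (hW : ∀ Ψ : E → ℝ, ContDiff ℝ ∞ Ψ → HasCompactSupport Ψ → tsupport Ψ ⊆ U →
      ∑ i, ∫ z, fderiv ℝ Ψ z (b i) • fderiv ℝ F z (b i) ∂μ = 0)
    {Ψ ψ : E → ℝ} (hΨ : ContDiff ℝ ∞ Ψ) (hψ : Continuous ψ)
    (hΨs : tsupport Ψ ⊆ closedBall 0 ρ) (hψs : tsupport ψ ⊆ closedBall 0 ρ)
    (hΨψ : ∀ y i, fderiv ℝ Ψ y (b i) = 2 * b.repr y i * ψ y) (heven : ∀ y, ψ (-y) = ψ y)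
    {z : E} (hz : closedBall z ρ ⊆ U) {δ : ℝ} (hδ0 : 0 ≤ δ) (hδ1 : δ ≤ 1) :
    ∫ y, ψ y • fderiv ℝ F (z - δ • y) (-y) ∂μ = 0 := by
  rcases hδ0.eq_or_lt with rfl | hδ
  · have h := integral_neg_eq_self (fun y => ψ y • fderiv ℝ F (z - (0 : ℝ) • y) (-y)) μ
    simp only [heven, zero_smul, neg_neg, map_neg, smul_neg, integral_neg, neg_zero, sub_zero] at h ⊢
    have h2 : (2 : ℝ) • (∫ y, ψ y • fderiv ℝ F z y ∂μ) = 0 := by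
      rw [two_smul]
      nth_rewrite 1 [h]
      simp
    simpa using h2
  have hF' := hF.continuous_fderiv one_ne_zero
  have hψc : HasCompactSupport ψ :=
    HasCompactSupport.of_support_subset_isCompact (isCompact_closedBall 0 ρ)
      ((subset_tsupport _).trans hψs)
  set Ψδ : E → ℝ := fun w => Ψ (δ⁻¹ • (z - w)) with hΨδ
  have hΨδs : tsupport Ψδ ⊆ closedBall z ρ := by
    refine closure_minimal (fun w hw => ?_) isClosed_closedBall
    have h1 : δ⁻¹ • (z - w) ∈ closedBall (0 : E) ρ := hΨs (subset_tsupport _ hw)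
    rw [mem_closedBall_zero_iff, norm_smul, Real.norm_of_nonneg (by positivity),
      inv_mul_le_iff₀ hδ] at h1
    rw [mem_closedBall', dist_eq_norm]
    have hρ : 0 ≤ δ * ρ := (norm_nonneg _).trans h1
    have hρ' : 0 ≤ ρ := nonneg_of_mul_nonneg_right hρ hδ
    nlinarith
  have hΨδc : HasCompactSupport Ψδ :=
    HasCompactSupport.of_support_subset_isCompact (isCompact_closedBall z ρ)
      ((subset_tsupport _).trans hΨδs)
  have hd : ∀ w i, fderiv ℝ Ψδ w (b i) = -δ⁻¹ * fderiv ℝ Ψ (δ⁻¹ • (z - w)) (b i) := by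
    intro w i
    have h1 : HasFDerivAt (fun w : E => δ⁻¹ • (z - w)) (δ⁻¹ • -ContinuousLinearMap.id ℝ E) w :=
      ((hasFDerivAt_id w).const_sub z).const_smul δ⁻¹
    have h2 := (hΨ.differentiable (by simp) (δ⁻¹ • (z - w))).hasFDerivAt.comp w h1
    have h3 : fderiv ℝ Ψδ w = _ := h2.fderiv
    rw [h3]; simp
  have key := hW Ψδ (by rw [hΨδ]; exact hΨ.comp (by fun_prop)) hΨδc (hΨδs.trans hz)
  have hi : ∀ i, ∫ y, (2 * b.repr y i * ψ y) • fderiv ℝ F (z - δ • y) (b i) ∂μ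
      = |(δ ^ Module.finrank ℝ E)⁻¹| • (-δ) •
        ∫ w, fderiv ℝ Ψδ w (b i) • fderiv ℝ F w (b i) ∂μ := by
    intro i
    set h : E → G := fun w => fderiv ℝ Ψ (δ⁻¹ • (z - w)) (b i) • fderiv ℝ F w (b i) with hh
    have e1 : ∀ y, (2 * b.repr y i * ψ y) • fderiv ℝ F (z - δ • y) (b i)
        = (fun y => h (z - y)) (δ • y) := by
      intro y
      simp [hh, ← hΨψ, smul_smul, hδ.ne']
    simp_rw [e1]
    rw [Measure.integral_comp_smul μ (fun y => h (z - y)) δ, integral_sub_left_eq_self h μ z,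
      ← integral_smul (-δ)]
    congr 2
    ext w
    simp only [hh, hd, smul_smul]
    congr 1
    field_simp
  have hsum : ∑ i, ∫ y, (2 * b.repr y i * ψ y) • fderiv ℝ F (z - δ • y) (b i) ∂μ = 0 := by
    simp_rw [hi]
    rw [← Finset.smul_sum, ← Finset.smul_sum, key, smul_zero, smul_zero]
  have hrep : ∀ i, Continuous fun y => b.repr y i := fun i => (contDiff_repr b i).continuous
  rw [← integral_finsetSum] at hsum
  · have : ∀ y, ψ y • fderiv ℝ F (z - δ • y) (-y) = (-(2 : ℝ)⁻¹) •
        ∑ i, (2 * b.repr y i * ψ y) • fderiv ℝ F (z - δ • y) (b i) := by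
      intro y
      have hy : fderiv ℝ F (z - δ • y) y =
          ∑ i, b.repr y i • fderiv ℝ F (z - δ • y) (b i) := by
        conv_lhs => enter [2]; rw [← b.sum_repr y]
        simp only [map_sum, map_smul]
      rw [map_neg, hy, Finset.smul_sum, smul_neg, Finset.smul_sum, ← Finset.sum_neg_distrib]
      refine Finset.sum_congr rfl fun i _ => ?_
      simp only [smul_smul, ← neg_smul]
      congr 1
      ring
    simp_rw [this]
    rw [integral_smul, hsum, smul_zero]
  · intro i _
    have := hrep i
    exact Continuous.integrable_of_hasCompactSupport (by fun_prop)
      ((hψc.mul_left (f := fun y => 2 * b.repr y i)).smul_right)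

/-- **Weyl's lemma** for `C¹` functions with compact support, in a weak formulation. -/
theorem contDiffAt_of_weakly_harmonic [Nonempty ι] [CompleteSpace G] {F : E → G}
    (hF : ContDiff ℝ 1 F) (hFc : HasCompactSupport F) {U : Set E} (hU : IsOpen U) {z₀ : E}
    (hz₀ : z₀ ∈ U)
    (hW : ∀ Ψ : E → ℝ, ContDiff ℝ ∞ Ψ → HasCompactSupport Ψ → tsupport Ψ ⊆ U →
      ∑ i, ∫ z, fderiv ℝ Ψ z (b i) • fderiv ℝ F z (b i) ∂μ = 0) :
    ContDiffAt ℝ ∞ F z₀ := by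
  classical
  obtain ⟨r, hr, hrU⟩ := Metric.isOpen_iff.1 hU z₀ hz₀
  have hρ : 0 < r / 2 := by positivity
  obtain ⟨Ψ, ψ, hΨ, hψ, hΨs, hψs, hΨψ, heven, hne⟩ := exists_radial_test b μ hρ
  have hψc : HasCompactSupport ψ :=
    HasCompactSupport.of_support_subset_isCompact (isCompact_closedBall 0 (r / 2))
      ((subset_tsupport _).trans hψs)
  have hconv : ContDiff ℝ ∞ (convolution ψ F (ContinuousLinearMap.lsmul ℝ ℝ) μ) :=
    hψc.contDiff_convolution_left _ hψ hF.continuous.locallyIntegrable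
  have hEq : F =ᶠ[𝓝 z₀] fun z => (∫ y, ψ y ∂μ)⁻¹ •
      convolution ψ F (ContinuousLinearMap.lsmul ℝ ℝ) μ z := by
    filter_upwards [Metric.ball_mem_nhds z₀ hρ] with z hz
    have hzU : closedBall z (r / 2) ⊆ U := by
      refine subset_trans (fun w hw => ?_) hrU
      rw [mem_closedBall] at hw
      rw [mem_ball] at hz ⊢
      linarith [dist_triangle w z z₀]
    have hder := hasDerivAt_integral_dilate μ hF hFc hψ.continuous hψc z
    have hconst := constant_of_has_deriv_right_zero (a := 0) (b := 1)
      (fun δ _ => (hder δ).continuousAt.continuousWithinAt) (fun δ hδ => by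
        have := hder δ
        rw [integral_dilate_deriv_eq_zero b μ hF hW hΨ hψ.continuous hΨs hψs hΨψ heven hzU
          hδ.1 hδ.2.le] at this
        exact this.hasDerivWithinAt) 1 (by simp)
    simp only [one_smul, zero_smul, sub_zero] at hconst
    have hcv : convolution ψ F (ContinuousLinearMap.lsmul ℝ ℝ) μ z
        = ∫ y, ψ y • F (z - y) ∂μ := rfl
    rw [hcv, hconst, integral_smul_const, smul_smul, inv_mul_cancel₀ hne, one_smul]
  exact (hconv.const_smul _).contDiffAt.congr_of_eventuallyEq hEq

end Weyl

section Weyl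

variable {E : Type*} [NormedAddCommGroup E] [NormedSpace ℝ E]
  {G : Type*} [NormedAddCommGroup G] [NormedSpace ℝ G]

lemma contDiff_smul_of_tsupport_subset {n : WithTop ℕ∞} {U : Set E} (hU : IsOpen U)
    {η : E → ℝ} {F : E → G} (hη : ContDiff ℝ n η) (hsupp : tsupport η ⊆ U)
    (hF : ContDiffOn ℝ n F U) : ContDiff ℝ n (fun z => η z • F z) := by
  refine contDiff_iff_contDiffAt.2 fun x => ?_
  by_cases hx : x ∈ tsupport η
  · exact hη.contDiffAt.smul (hF.contDiffAt (hU.mem_nhds (hsupp hx)))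
  · refine (contDiffAt_const (c := (0 : G))).congr_of_eventuallyEq ?_
    filter_upwards [notMem_tsupport_iff_eventuallyEq.1 hx] with y hy
    simp [hy]

variable {ι : Type*} [Fintype ι] (b : Module.Basis ι ℝ E)

variable [FiniteDimensional ℝ E] [MeasurableSpace E] [BorelSpace E]
    (μ : Measure E) [μ.IsAddHaarMeasure]

/-- Weyl's lemma on an open set. -/
theorem contDiffOn_of_weakly_harmonic [Nonempty ι] [CompleteSpace G] {F : E → G} {D : Set E}
    (hD : IsOpen D) (hF : ContDiffOn ℝ 1 F D)
    (hW : ∀ Ψ : E → ℝ, ContDiff ℝ ∞ Ψ → HasCompactSupport Ψ → tsupport Ψ ⊆ D →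
      ∑ i, ∫ z, fderiv ℝ Ψ z (b i) • fderiv ℝ F z (b i) ∂μ = 0) :
    ContDiffOn ℝ ∞ F D := by
  intro z₀ hz₀
  obtain ⟨r, hr, hrD⟩ := Metric.isOpen_iff.1 hD z₀ hz₀
  let χ : ContDiffBump z₀ := ⟨r / 4, r / 2, by positivity, by linarith⟩
  have hχs : tsupport χ ⊆ D := by
    rw [χ.tsupport_eq]
    exact (closedBall_subset_ball (by simp [χ]; linarith)).trans hrD
  have heq : ∀ z ∈ ball z₀ (r / 4), (fun z => χ z • F z) =ᶠ[𝓝 z] F := by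
    intro z hz
    filter_upwards [isOpen_ball.mem_nhds hz] with w hw
    rw [χ.one_of_mem_closedBall (ball_subset_closedBall hw), one_smul]
  have h0 : z₀ ∈ ball z₀ (r / 4) := mem_ball_self (by positivity)
  have h := contDiffAt_of_weakly_harmonic b μ (F := fun z => χ z • F z)
    (contDiff_smul_of_tsupport_subset hD χ.contDiff hχs hF)
    χ.hasCompactSupport.smul_right isOpen_ball h0 (fun Ψ hΨ hΨc hΨs => by
      rw [← hW Ψ hΨ hΨc (hΨs.trans ((ball_subset_ball (by linarith)).trans hrD))]
      refine Finset.sum_congr rfl fun i _ => integral_congr_ae (Eventually.of_forall fun z => ?_)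
      by_cases hz : z ∈ tsupport Ψ
      · simp only [(heq z (hΨs hz)).fderiv_eq]
      · have : fderiv ℝ Ψ z = 0 := by
          rw [(notMem_tsupport_iff_eventuallyEq.1 hz).fderiv_eq]; simp
        simp [this])
  exact (h.congr_of_eventuallyEq (heq z₀ h0).symm).contDiffWithinAt

lemma integral_fderiv_smul_fderiv_symm {D : Set E} (hD : IsOpen D) {F : E → G}
    (hF : ContDiffOn ℝ 1 F D) {Ψ : E → ℝ} (hΨ : ContDiff ℝ ∞ Ψ) (hc : HasCompactSupport Ψ)
    (hs : tsupport Ψ ⊆ D) (v w : E) :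
    ∫ z, fderiv ℝ Ψ z v • fderiv ℝ F z w ∂μ = ∫ z, fderiv ℝ Ψ z w • fderiv ℝ F z v ∂μ := by
  have hd : ∀ v : E, ContDiff ℝ 1 fun z => fderiv ℝ Ψ z v := fun v =>
    (hΨ.fderiv_right (m := 1) (by norm_cast)).clm_apply contDiff_const
  have hs' : ∀ v : E, tsupport (fun z => fderiv ℝ Ψ z v) ⊆ tsupport Ψ := fun v =>
    tsupport_fderiv_apply_subset ℝ v
  have hc' : ∀ v : E, HasCompactSupport fun z => fderiv ℝ Ψ z v := fun v =>
    hc.mono' ((subset_tsupport _).trans (hs' v))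
  rw [integral_smul_fderiv_of_tsupport_subset μ hD (hd v) (hc' v) ((hs' v).trans hs) hF w,
    integral_smul_fderiv_of_tsupport_subset μ hD (hd w) (hc' w) ((hs' w).trans hs) hF v]
  congr 2
  ext z
  have hdiff : DifferentiableAt ℝ (fderiv ℝ Ψ) z :=
    (hΨ.fderiv_right (m := 1) (by norm_cast)).differentiable one_ne_zero z
  have hsymm : IsSymmSndFDerivAt ℝ Ψ z :=
    hΨ.contDiffAt.isSymmSndFDerivAt (by
      rw [minSmoothness_of_isRCLikeNormedField]; norm_cast)
  rw [fderiv_clm_apply hdiff (by fun_prop), fderiv_clm_apply hdiff (by fun_prop)]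
  simp [hsymm v w]

end Weyl

section CliffordAlgebraIdentities

variable (p q : ℕ) {A : Type*} [NormedRing A] [NormedAlgebra ℝ A] (ξ : A ≃ₐ[ℝ] Cl (p + q))

lemma e_mul_e_add (n : ℕ) (i j : Fin n) :
    e n i * e n j + e n j * e n i = if i = j then -2 else 0 := by
  unfold e
  rw [CliffordAlgebra.ι_mul_ι_add_swap]
  have : QuadraticMap.polar (Qe n) (Pi.single i 1) (Pi.single j 1)
      = if i = j then -2 else 0 := by
    simp only [QuadraticMap.polar, Qe, QuadraticMap.weightedSumSquares_apply, Pi.add_apply,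
      ← Finset.sum_sub_distrib]
    have h : ∀ k, (-1 : ℝ) • (((Pi.single i 1 : Fin n → ℝ) k + (Pi.single j 1 : Fin n → ℝ) k) *
          ((Pi.single i 1 : Fin n → ℝ) k + (Pi.single j 1 : Fin n → ℝ) k)) -
        (-1 : ℝ) • ((Pi.single i 1 : Fin n → ℝ) k * (Pi.single i 1 : Fin n → ℝ) k) -
        (-1 : ℝ) • ((Pi.single j 1 : Fin n → ℝ) k * (Pi.single j 1 : Fin n → ℝ) k)
        = (Pi.single i 1 : Fin n → ℝ) k * (-2 * (Pi.single j 1 : Fin n → ℝ) k) := by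
      intro k
      simp only [smul_eq_mul]
      ring
    simp_rw [h]
    by_cases hij : i = j
    · simp [hij, Pi.single_apply]
    · simp [hij, Pi.single_apply, Ne.symm hij]
  rw [this]
  split_ifs <;> simp [map_ofNat]

lemma gen_mul_gen_add (i j : Fin (p + q)) :
    gen p q ξ i * gen p q ξ j + gen p q ξ j * gen p q ξ i = if i = j then -2 else 0 := by
  unfold gen
  rw [← map_mul, ← map_mul, ← map_add, e_mul_e_add]
  split_ifs <;> simp [map_ofNat]

/-- The conjugates `1, -e_1, …, -e_p` of the paravector basis. -/
def εbar (i : Fin (p + 1)) : A := Fin.cases 1 (fun i => -eP p q ξ i) i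

lemma εp_zero : εp p q ξ 0 = 1 := by simp [εp]

lemma εp_succ (i : Fin p) : εp p q ξ i.succ = eP p q ξ i := by simp [εp, eP]

lemma eP_mul_eP_add (i j : Fin p) :
    eP p q ξ i * eP p q ξ j + eP p q ξ j * eP p q ξ i = if i = j then -2 else 0 := by
  unfold eP
  rw [gen_mul_gen_add]
  simp [Fin.ext_iff]

lemma εbar_mul_εp_add (i j : Fin (p + 1)) :
    εbar p q ξ j * εp p q ξ i + εbar p q ξ i * εp p q ξ j = if i = j then 2 else 0 := by
  refine Fin.cases ?_ (fun i => ?_) i <;> refine Fin.cases ?_ (fun j => ?_) j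
  · simp [εbar, εp_zero]; norm_num
  · simp [εbar, εp_zero, εp_succ, (Fin.succ_ne_zero j).symm]
  · simp [εbar, εp_zero, εp_succ]
  · have := eP_mul_eP_add p q ξ j i
    simp only [εbar, εp_succ, Fin.cases_succ, neg_mul, Fin.succ_inj]
    rw [← neg_add, this]
    by_cases h : i = j <;> simp [h, eq_comm]

lemma εp_mul_εbar_add (i j : Fin (p + 1)) :
    εp p q ξ j * εbar p q ξ i + εp p q ξ i * εbar p q ξ j = if i = j then 2 else 0 := by
  refine Fin.cases ?_ (fun i => ?_) i <;> refine Fin.cases ?_ (fun j => ?_) j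
  · simp [εbar, εp_zero]; norm_num
  · simp [εbar, εp_zero, εp_succ, (Fin.succ_ne_zero j).symm]
  · simp [εbar, εp_zero, εp_succ]
  · have := eP_mul_eP_add p q ξ j i
    simp only [εbar, εp_succ, Fin.cases_succ, mul_neg, Fin.succ_inj]
    rw [← neg_add, this]
    by_cases h : i = j <;> simp [h, eq_comm]

end CliffordAlgebraIdentities

/-- If `a j * c i + a i * c j = 2 δ_{ij}`, the second-order expression with coefficients `a`, `c`
reduces to a trace. -/
lemma sum_mul_sum_eq_trace {κ : Type*} [Fintype κ] [DecidableEq κ] {A : Type*} [Ring A]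
    [Algebra ℝ A] {a c : κ → A}
    (hac : ∀ i j, a j * c i + a i * c j = if i = j then 2 else 0) {M : κ → κ → A}
    (hM : ∀ i j, M i j = M j i) :
    ∑ j, a j * ∑ i, c i * M j i = ∑ i, M i i := by
  have h1 : ∑ j, a j * ∑ i, c i * M j i = ∑ j, ∑ i, a j * c i * M j i := by
    simp_rw [Finset.mul_sum, mul_assoc]
  have h2 : ∑ j, ∑ i, a j * c i * M j i = ∑ j, ∑ i, a i * c j * M j i := by
    rw [Finset.sum_comm]
    exact Finset.sum_congr rfl fun j _ => Finset.sum_congr rfl fun i _ => by rw [hM i j]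
  have h3 : (2 : ℝ) • ∑ j, ∑ i, a j * c i * M j i = (2 : ℝ) • ∑ i, M i i := by
    rw [two_smul]
    nth_rewrite 2 [h2]
    rw [← Finset.sum_add_distrib, Finset.smul_sum]
    refine Finset.sum_congr rfl fun j _ => ?_
    rw [← Finset.sum_add_distrib]
    simp_rw [← add_mul, hac, ite_mul, zero_mul]
    simp [two_mul, two_smul]
  rw [h1]
  exact smul_right_injective A (two_ne_zero (α := ℝ)) h3

lemma finiteDimensional_Cl (n : ℕ) : FiniteDimensional ℝ (Cl n) := by
  have : Module.Finite ℝ (ExteriorAlgebra ℝ (Fin n → ℝ)) :=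
    Module.Finite.of_basis (Pi.basisFun ℝ (Fin n)).ExteriorAlgebra
  exact Module.Finite.equiv (CliffordAlgebra.equivExterior (Qe n)).symm

section

variable (p q : ℕ) {A : Type*} [NormedRing A] [NormedAlgebra ℝ A] (ξ : A ≃ₐ[ℝ] Cl (p + q))

include ξ in
lemma completeSpace_of_equiv_Cl : CompleteSpace A := by
  have := finiteDimensional_Cl (p + q)
  have : FiniteDimensional ℝ A := Module.Finite.equiv ξ.symm.toLinearEquiv
  exact FiniteDimensional.complete ℝ A

instance : (volume : Measure (Sl p)).IsAddHaarMeasure :=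
  inferInstanceAs ((volume : Measure (Vp p)).prod (volume : Measure ℝ)).IsAddHaarMeasure

/-- The standard basis of `ℝ^{p+2}`. -/
def slBasis : Module.Basis (Fin (p + 1) ⊕ Unit) ℝ (Sl p) :=
  (Pi.basisFun ℝ (Fin (p + 1))).prod (Module.Basis.singleton Unit ℝ)

lemma slBasis_inl (i : Fin (p + 1)) : slBasis p (Sum.inl i) = (Pi.single i 1, 0) := by
  simp [slBasis]

lemma slBasis_inr (u : Unit) : slBasis p (Sum.inr u) = (0, 1) := by
  simp [slBasis]

lemma DPbar_eq (F : Sl p → A) (z : Sl p) :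
    DPbar p q ξ F z = ∑ i, εbar p q ξ i * pdSl p i F z := by
  simp [DPbar, Fin.sum_univ_succ, εbar, sub_eq_add_neg]

lemma sum_trace_first {M : Fin (p + 1) → Fin (p + 1) → A} {N : Fin (p + 1) → A} {R : A}
    (hM : ∀ i j, M i j = M j i) (h1 : ∀ j, ∑ i, εp p q ξ i * M j i = N j)
    (h2 : ∑ j, εbar p q ξ j * N j = -R) : ∑ i, M i i + R = 0 := by
  rw [← sum_mul_sum_eq_trace (fun i j => εbar_mul_εp_add p q ξ i j) hM]
  simp_rw [h1, h2]
  simp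

lemma sum_trace_second {M : Fin (p + 1) → Fin (p + 1) → A} {N : Fin (p + 1) → A} {R : A}
    (hM : ∀ i j, M i j = M j i) (h1 : ∀ j, ∑ i, εbar p q ξ i * M j i = -N j)
    (h2 : ∑ j, εp p q ξ j * N j = R) : ∑ i, M i i + R = 0 := by
  rw [← sum_mul_sum_eq_trace (fun i j => εp_mul_εbar_add p q ξ i j) hM]
  simp_rw [h1, mul_neg, Finset.sum_neg_distrib, h2]
  simp

variable {D : Set (Sl p)} {F1 F2 : Sl p → A}

/-- Multiplication by Clifford constants passes under the integral sign. -/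
lemma sum_mul_integral_smul (hD : IsOpen D) {F : Sl p → A} (hF : ContDiffOn ℝ 1 F D)
    {Ψ : Sl p → ℝ} (hΨ : ContDiff ℝ ∞ Ψ) (hc : HasCompactSupport Ψ) (hs : tsupport Ψ ⊆ D)
    (c : Fin (p + 1) → A) (v : Sl p) {H : Sl p → A}
    (hH : ∀ z ∈ D, ∑ i, c i * pdSl p i F z = H z) :
    ∑ i, c i * ∫ z, fderiv ℝ Ψ z v • fderiv ℝ F z (Pi.single i 1, 0)
      = ∫ z, fderiv ℝ Ψ z v • H z := by
  have hη : Continuous fun z => fderiv ℝ Ψ z v :=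
    (hΨ.continuous_fderiv (by simp)).clm_apply continuous_const
  have hs' : tsupport (fun z => fderiv ℝ Ψ z v) ⊆ tsupport Ψ := tsupport_fderiv_apply_subset ℝ v
  have hc' : HasCompactSupport fun z => fderiv ℝ Ψ z v :=
    hc.mono' ((subset_tsupport _).trans hs')
  have hint : ∀ i : Fin (p + 1), Integrable fun z : Sl p =>
      fderiv ℝ Ψ z v • fderiv ℝ F z (Pi.single i 1, 0) := fun i =>
    integrable_smul_of_tsupport_subset volume hD hη hc' (hs'.trans hs)
      ((hF.continuousOn_fderiv_of_isOpen hD le_rfl).clm_apply continuousOn_const)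
  simp_rw [← fun i => integral_const_mul_of_integrable (hint i) (c := c i)]
  rw [← integral_finsetSum (f := fun i z => c i * fderiv ℝ Ψ z v • fderiv ℝ F z (Pi.single i 1, 0))
    _ fun i _ => (hint i).const_mul' (c i)]
  refine integral_congr_ae (Eventually.of_forall fun z => ?_)
  simp only [mul_smul_comm]
  by_cases hz : z ∈ D
  · rw [← hH z hz, Finset.smul_sum]
    rfl
  · have : fderiv ℝ Ψ z v = 0 :=
      image_eq_zero_of_notMem_tsupport (f := fun z => fderiv ℝ Ψ z v) fun h => hz (hs (hs' h))
    simp [this]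

lemma weakly_harmonic_of_CRSystem (hD : IsOpen D) (hF1 : ContDiffOn ℝ 1 F1 D)
    (hF2 : ContDiffOn ℝ 1 F2 D) (hCR : CRSystem p q ξ D F1 F2)
    {Ψ : Sl p → ℝ} (hΨ : ContDiff ℝ ∞ Ψ) (hc : HasCompactSupport Ψ) (hs : tsupport Ψ ⊆ D) :
    (∑ i, ∫ z, fderiv ℝ Ψ z (slBasis p i) • fderiv ℝ F1 z (slBasis p i) = 0) ∧
      ∑ i, ∫ z, fderiv ℝ Ψ z (slBasis p i) • fderiv ℝ F2 z (slBasis p i) = 0 := by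
  have hsym1 := integral_fderiv_smul_fderiv_symm volume hD hF1 hΨ hc hs
  have hsym2 := integral_fderiv_smul_fderiv_symm volume hD hF2 hΨ hc hs
  have h1 : ∀ v, ∑ i, εp p q ξ i * ∫ z, fderiv ℝ Ψ z v • fderiv ℝ F1 z (Pi.single i 1, 0)
      = ∫ z, fderiv ℝ Ψ z v • fderiv ℝ F2 z (0, 1) := fun v =>
    sum_mul_integral_smul p hD hF1 hΨ hc hs _ v fun z hz => sub_eq_zero.1 (hCR z hz).1
  have h2 : ∀ v, ∑ i, εbar p q ξ i * ∫ z, fderiv ℝ Ψ z v • fderiv ℝ F2 z (Pi.single i 1, 0)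
      = -∫ z, fderiv ℝ Ψ z v • fderiv ℝ F1 z (0, 1) := fun v => by
    rw [sum_mul_integral_smul p hD hF2 hΨ hc hs _ v (H := fun z => -pdr p F1 z) fun z hz => by
      rw [← DPbar_eq]; exact eq_neg_of_add_eq_zero_left (hCR z hz).2, ← integral_neg]
    simp [pdr]
  constructor
  · simp only [Fintype.sum_sum_type, slBasis_inl, slBasis_inr, Finset.univ_unique,
      Finset.sum_singleton]
    refine sum_trace_first p q ξ (M := fun i j => ∫ z, fderiv ℝ Ψ z (Pi.single i 1, 0) •
      fderiv ℝ F1 z (Pi.single j 1, 0)) (fun i j => hsym1 _ _) (fun j => h1 _) ?_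
    simp_rw [hsym2 _ (0, 1)]
    exact h2 _
  · simp only [Fintype.sum_sum_type, slBasis_inl, slBasis_inr, Finset.univ_unique,
      Finset.sum_singleton]
    refine sum_trace_second p q ξ (M := fun i j => ∫ z, fderiv ℝ Ψ z (Pi.single i 1, 0) •
      fderiv ℝ F2 z (Pi.single j 1, 0)) (fun i j => hsym2 _ _) (fun j => h2 _) ?_
    simp_rw [hsym1 _ (0, 1)]
    exact h1 _

/-- Solutions of the Cauchy–Riemann system are smooth. -/
lemma contDiffOn_of_CRSystem (hD : IsOpen D) (hF1 : ContDiffOn ℝ 1 F1 D)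
    (hF2 : ContDiffOn ℝ 1 F2 D) (hCR : CRSystem p q ξ D F1 F2) :
    ContDiffOn ℝ ∞ F1 D ∧ ContDiffOn ℝ ∞ F2 D := by
  have := completeSpace_of_equiv_Cl p q ξ
  exact ⟨contDiffOn_of_weakly_harmonic (slBasis p) volume hD hF1 fun Ψ h1 h2 h3 =>
      (weakly_harmonic_of_CRSystem p q ξ hD hF1 hF2 hCR h1 h2 h3).1,
    contDiffOn_of_weakly_harmonic (slBasis p) volume hD hF2 fun Ψ h1 h2 h3 =>
      (weakly_harmonic_of_CRSystem p q ξ hD hF1 hF2 hCR h1 h2 h3).2⟩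

end

section Calculus

variable {E : Type*} [NormedAddCommGroup E] [NormedSpace ℝ E]
  {G : Type*} [NormedAddCommGroup G] [NormedSpace ℝ G]

lemma contDiffOn_fderiv_apply {D : Set E} (hD : IsOpen D) {F : E → G} (hF : ContDiffOn ℝ ∞ F D)
    (v : E) : ContDiffOn ℝ ∞ (fun z => fderiv ℝ F z v) D :=
  (hF.fderiv_of_isOpen hD (by simp)).clm_apply contDiffOn_const

lemma fderiv_fderiv_apply_comm {D : Set E} (hD : IsOpen D) {F : E → G} (hF : ContDiffOn ℝ ∞ F D)
    {z : E} (hz : z ∈ D) (v w : E) :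
    fderiv ℝ (fun z => fderiv ℝ F z v) z w = fderiv ℝ (fun z => fderiv ℝ F z w) z v := by
  have hFz := hF.contDiffAt (hD.mem_nhds hz)
  have hdiff : DifferentiableAt ℝ (fderiv ℝ F) z :=
    ((hF.fderiv_of_isOpen (m := ∞) hD (by simp)).contDiffAt (hD.mem_nhds hz)).differentiableAt
      (by simp)
  have hsymm : IsSymmSndFDerivAt ℝ F z :=
    hFz.isSymmSndFDerivAt (by rw [minSmoothness_of_isRCLikeNormedField]; norm_cast)
  rw [fderiv_clm_apply hdiff (by fun_prop), fderiv_clm_apply hdiff (by fun_prop)]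
  simp [hsymm v w]

end Calculus

section

variable (p q : ℕ) {A : Type*} [NormedRing A] [NormedAlgebra ℝ A] (ξ : A ≃ₐ[ℝ] Cl (p + q))
variable {D : Set (Sl p)} {F1 F2 : Sl p → A}

lemma sum_mul_fderiv (hD : IsOpen D) {F : Sl p → A} (hF : ContDiffOn ℝ ∞ F D)
    (c : Fin (p + 1) → A) (v : Sl p) {H : Sl p → A}
    (hH : ∀ z ∈ D, ∑ i, c i * pdSl p i F z = H z) {z : Sl p} (hz : z ∈ D) :
    ∑ i, c i * fderiv ℝ (pdSl p i F) z v = fderiv ℝ H z v := by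
  have heq : H =ᶠ[𝓝 z] fun w => ∑ i, c i * pdSl p i F w := by
    filter_upwards [hD.mem_nhds hz] with w hw using (hH w hw).symm
  have hd : ∀ i, DifferentiableAt ℝ (pdSl p i F) z := fun i =>
    ((contDiffOn_fderiv_apply hD hF _).contDiffAt (hD.mem_nhds hz)).differentiableAt (by simp)
  rw [heq.fderiv_eq, fderiv_fun_sum fun i _ => (hd i).const_mul (c i)]
  simp only [sum_apply]
  exact Finset.sum_congr rfl fun i _ => by rw [fderiv_const_mul (hd i)]; rfl

/-- Solutions of the Cauchy–Riemann system are harmonic. -/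
lemma LapSl_eq_zero_of_CRSystem (hD : IsOpen D) (hF1 : ContDiffOn ℝ ∞ F1 D)
    (hF2 : ContDiffOn ℝ ∞ F2 D) (hCR : CRSystem p q ξ D F1 F2) {z : Sl p} (hz : z ∈ D) :
    LapSl p F1 z = 0 ∧ LapSl p F2 z = 0 := by
  have hsym1 := fderiv_fderiv_apply_comm hD hF1 hz
  have hsym2 := fderiv_fderiv_apply_comm hD hF2 hz
  have h1 : ∀ v, ∑ i, εp p q ξ i * fderiv ℝ (pdSl p i F1) z v = fderiv ℝ (pdr p F2) z v := fun v =>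
    sum_mul_fderiv p hD hF1 _ v (fun z hz => sub_eq_zero.1 (hCR z hz).1) hz
  have h2 : ∀ v, ∑ i, εbar p q ξ i * fderiv ℝ (pdSl p i F2) z v
      = -fderiv ℝ (pdr p F1) z v := fun v => by
    rw [sum_mul_fderiv p hD hF2 _ v (H := fun z => -pdr p F1 z) (fun z hz => by
      rw [← DPbar_eq]; exact eq_neg_of_add_eq_zero_left (hCR z hz).2) hz]
    simp
  constructor
  · refine sum_trace_first p q ξ (M := fun i j => fderiv ℝ (pdSl p j F1) z (Pi.single i 1, 0))
      (fun i j => hsym1 _ _) (fun j => h1 _) ?_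
    refine Eq.trans (Finset.sum_congr rfl fun j _ => ?_) (h2 (0, 1))
    exact congrArg _ (hsym2 _ _)
  · refine sum_trace_second p q ξ (M := fun i j => fderiv ℝ (pdSl p j F2) z (Pi.single i 1, 0))
      (fun i j => hsym2 _ _) (fun j => h2 _) ?_
    refine Eq.trans (Finset.sum_congr rfl fun j _ => ?_) (h1 (0, 1))
    exact congrArg _ (hsym1 _ _)

end

lemma contDiff_integral_zero_one {P G : Type*} [NormedAddCommGroup P] [NormedSpace ℝ P]
    [NormedAddCommGroup G] [NormedSpace ℝ G] {g : P → ℝ → G} (hg : ContDiff ℝ ∞ ↿g) :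
    ContDiff ℝ ∞ fun x => ∫ t in (0 : ℝ)..1, g x t := by
  let χ : ContDiffBump (0 : ℝ) := ⟨1, 2, one_pos, one_lt_two⟩
  let h : P → ℝ → G := fun x t => χ t • g x (-t)
  have hh : ContDiff ℝ ∞ ↿h := by
    have h1 : ContDiff ℝ ∞ fun y : P × ℝ => χ y.2 := χ.contDiff.comp contDiff_snd
    exact h1.smul (hg.comp (contDiff_fst.prodMk contDiff_snd.neg))
  have key := contDiffOn_convolution_right_with_param (μ := volume) (n := ⊤)
    (f := Set.indicator (Set.Ioc (0 : ℝ) 1) fun _ => (1 : ℝ)) (ContinuousLinearMap.lsmul ℝ ℝ)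
    (g := h) isOpen_univ (isCompact_closedBall (0 : ℝ) 2)
    (fun x t _ ht => by
      have : χ t = 0 := χ.zero_of_le_dist
        (by rw [mem_closedBall] at ht; exact (not_le.1 ht).le)
      simp [h, this])
    (((integrable_indicator_iff measurableSet_Ioc).2
      (integrableOn_const (by simp))).locallyIntegrable) hh.contDiffOn
  have key2 : ContDiff ℝ ∞ fun x => convolution
      (Set.indicator (Set.Ioc (0 : ℝ) 1) fun _ => (1 : ℝ)) (h x)
      (ContinuousLinearMap.lsmul ℝ ℝ) volume 0 := by
    rw [Set.univ_prod_univ, contDiffOn_univ] at key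
    exact key.comp (contDiff_id.prodMk contDiff_const)
  refine (congrArg (ContDiff ℝ ∞) (funext fun x => ?_)).mpr key2
  rw [intervalIntegral.integral_of_le zero_le_one, ← integral_indicator measurableSet_Ioc]
  unfold convolution
  refine integral_congr_ae (Eventually.of_forall fun t => ?_)
  by_cases ht : t ∈ Set.Ioc (0 : ℝ) 1
  · have : χ (-t) = 1 := χ.one_of_mem_closedBall (by
      simpa [χ, abs_of_pos ht.1] using ht.2)
    simp [ht, h, this]
  · simp [ht]

section DivR

variable (p : ℕ) {G : Type*} [NormedAddCommGroup G] [NormedSpace ℝ G]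

/-- The quotient `H / r`, extended to `r = 0` by `∂_r H`. -/
def divR (H : Sl p → G) : Sl p → G := fun z => if z.2 = 0 then pdr p H z else z.2⁻¹ • H z

/-- The operator `(1/r) ∂_r`, extended to `r = 0`. -/
def radDiv (H : Sl p → G) : Sl p → G := divR p (pdr p H)

/-- Evenness in the last variable. -/
def EvenOn (D : Set (Sl p)) (F : Sl p → G) : Prop := ∀ z ∈ D, F (z.1, -z.2) = F z

/-- Oddness in the last variable. -/
def OddOn (D : Set (Sl p)) (F : Sl p → G) : Prop := ∀ z ∈ D, F (z.1, -z.2) = -F z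

variable {p} {D : Set (Sl p)} {H : Sl p → G}

lemma divR_of_ne {z : Sl p} (hz : z.2 ≠ 0) : divR p H z = z.2⁻¹ • H z := by simp [divR, hz]

lemma OddOn.eq_zero (hH : OddOn p D H) {z : Sl p} (hz : z ∈ D) (h0 : z.2 = 0) : H z = 0 := by
  have h := hH z hz
  have e : ((z.1, -z.2) : Sl p) = z := Prod.ext rfl (by simp [h0])
  rw [e] at h
  have h2 : (2 : ℝ) • H z = 0 := by
    rw [two_smul]
    nth_rewrite 1 [h]
    simp
  simpa using h2

lemma OddOn.smul_divR (hH : OddOn p D H) {z : Sl p} (hz : z ∈ D) : z.2 • divR p H z = H z := by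
  by_cases h0 : z.2 = 0
  · rw [hH.eq_zero hz h0, h0, zero_smul]
  · rw [divR_of_ne h0, smul_inv_smul₀ h0]

lemma OddOn.divR (hH : OddOn p D H) : EvenOn p D (divR p H) := by
  intro z hz
  by_cases h0 : z.2 = 0
  · have e : ((z.1, -z.2) : Sl p) = z := Prod.ext rfl (by simp [h0])
    rw [e]
  · rw [divR_of_ne h0, divR_of_ne (by simpa using h0), hH z hz]
    simp [inv_neg]

lemma EvenOn.pdr (hD : IsOpen D) (hrefl : ReflInv p D) (hH : EvenOn p D H)
    (hd : DifferentiableOn ℝ H D) : OddOn p D (pdr p H) := by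
  intro z hz
  have h1 : HasFDerivAt (fun w : Sl p => ((w.1, -w.2) : Sl p))
      ((ContinuousLinearMap.fst ℝ (Vp p) ℝ).prod (-ContinuousLinearMap.snd ℝ (Vp p) ℝ)) z :=
    hasFDerivAt_fst.prodMk hasFDerivAt_snd.neg
  have h2 := ((hd _ (hrefl z hz)).differentiableAt
    (hD.mem_nhds (hrefl z hz))).hasFDerivAt.comp z h1
  have h3 : (H ∘ fun w : Sl p => ((w.1, -w.2) : Sl p)) =ᶠ[𝓝 z] H := by
    filter_upwards [hD.mem_nhds hz] with w hw using hH w hw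
  have h4 := h2.fderiv
  rw [h3.fderiv_eq] at h4
  have e : ((0, -1) : Sl p) = -(0, 1) := by simp
  simp only [GPS.pdr, h4, ContinuousLinearMap.comp_apply, ContinuousLinearMap.prod_apply,
    ContinuousLinearMap.coe_fst', neg_apply, ContinuousLinearMap.coe_snd', e, map_neg, neg_neg]

lemma divR_congr {H' : Sl p → G} {z : Sl p} (h : H =ᶠ[𝓝 z] H') : divR p H z = divR p H' z := by
  simp only [divR, pdr, h.fderiv_eq, h.eq_of_nhds]

lemma contDiff_divR [CompleteSpace G] (hH : ContDiff ℝ ∞ H) (h0 : ∀ x, H (x, 0) = 0) :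
    ContDiff ℝ ∞ (divR p H) := by
  have hK : ContDiff ℝ ∞ (pdr p H) := by
    rw [← contDiffOn_univ]
    exact contDiffOn_fderiv_apply isOpen_univ hH.contDiffOn _
  have hJ : ContDiff ℝ ∞ fun z : Sl p => ∫ t in (0 : ℝ)..1, pdr p H (z.1, t * z.2) := by
    refine contDiff_integral_zero_one (g := fun (z : Sl p) t => pdr p H (z.1, t * z.2)) ?_
    have : ContDiff ℝ ∞ fun y : Sl p × ℝ => ((y.1.1, y.2 * y.1.2) : Sl p) := by fun_prop
    exact hK.comp this
  refine (congrArg (ContDiff ℝ ∞) (funext fun z => ?_)).mpr hJ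
  by_cases hz : z.2 = 0
  · simp only [divR, hz, if_true, mul_zero, intervalIntegral.integral_const, sub_zero, one_smul]
    rw [show ((z.1, 0) : Sl p) = z from Prod.ext rfl hz.symm]
  · have hder : ∀ t ∈ Set.uIcc (0 : ℝ) 1,
        HasDerivAt (fun t : ℝ => H (z.1, t * z.2)) (z.2 • pdr p H (z.1, t * z.2)) t := by
      intro t _
      have h1 : HasDerivAt (fun t : ℝ => ((z.1, t * z.2) : Sl p)) (0, z.2) t := by
        simpa using (hasDerivAt_const t z.1).prodMk ((hasDerivAt_id t).mul_const z.2)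
      have h2 := (hH.differentiable (by simp) (z.1, t * z.2)).hasFDerivAt.comp_hasDerivAt t h1
      have e : ((0, z.2) : Sl p) = z.2 • (0, 1) := by simp
      rw [e, map_smul] at h2
      exact h2
    have hcont : Continuous fun t : ℝ => z.2 • pdr p H (z.1, t * z.2) := by
      have := hK.continuous
      fun_prop
    have hint := intervalIntegral.integral_eq_sub_of_hasDerivAt hder
      (hcont.intervalIntegrable 0 1)
    simp only [one_mul, zero_mul, h0, sub_zero, intervalIntegral.integral_smul] at hint
    rw [divR_of_ne hz, ← Prod.mk.eta (p := z), ← hint, inv_smul_smul₀ hz]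

lemma OddOn.contDiffOn_divR [CompleteSpace G] (hD : IsOpen D) (hH : ContDiffOn ℝ ∞ H D)
    (hodd : OddOn p D H) : ContDiffOn ℝ ∞ (GPS.divR p H) D := by
  intro z₀ hz₀
  obtain ⟨r, hr, hrD⟩ := Metric.isOpen_iff.1 hD z₀ hz₀
  let χ : ContDiffBump z₀ := ⟨r / 4, r / 2, by positivity, by linarith⟩
  have hχs : tsupport χ ⊆ D := by
    rw [χ.tsupport_eq]
    exact (closedBall_subset_ball (by simp [χ]; linarith)).trans hrD
  have heq : ∀ z ∈ ball z₀ (r / 4), (fun z => χ z • H z) =ᶠ[𝓝 z] H := by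
    intro z hz
    filter_upwards [isOpen_ball.mem_nhds hz] with w hw
    rw [χ.one_of_mem_closedBall (ball_subset_closedBall hw), one_smul]
  have h := contDiff_divR (contDiff_smul_of_tsupport_subset hD χ.contDiff hχs hH) fun x => by
    by_cases hx : ((x, 0) : Sl p) ∈ tsupport χ
    · rw [hodd.eq_zero (hχs hx) rfl, smul_zero]
    · rw [image_eq_zero_of_notMem_tsupport hx, zero_smul]
  refine (h.contDiffAt.congr_of_eventuallyEq ?_).contDiffWithinAt
  filter_upwards [ball_mem_nhds z₀ (by positivity : 0 < r / 4)] with z hz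
  exact (divR_congr (heq z hz)).symm

variable (p) in
/-- Smooth functions on `D` that are even in the last variable. -/
structure SmoothEven (D : Set (Sl p)) (E : Sl p → G) : Prop where
  smooth : ContDiffOn ℝ ∞ E D
  even : EvenOn p D E

variable {E : Sl p → G}

lemma SmoothEven.odd_pdr (hD : IsOpen D) (hrefl : ReflInv p D) (hE : SmoothEven p D E) :
    OddOn p D (pdr p E) :=
  hE.even.pdr hD hrefl (hE.smooth.differentiableOn (by simp))

lemma SmoothEven.radDiv [CompleteSpace G] (hD : IsOpen D) (hrefl : ReflInv p D)
    (hE : SmoothEven p D E) : SmoothEven p D (radDiv p E) :=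
  ⟨(hE.odd_pdr hD hrefl).contDiffOn_divR hD (contDiffOn_fderiv_apply hD hE.smooth _),
    (hE.odd_pdr hD hrefl).divR⟩

lemma SmoothEven.iterate_radDiv [CompleteSpace G] (hD : IsOpen D) (hrefl : ReflInv p D)
    (hE : SmoothEven p D E) (k : ℕ) : SmoothEven p D ((GPS.radDiv p)^[k] E) := by
  induction k with
  | zero => exact hE
  | succ k ih =>
    rw [Function.iterate_succ_apply']
    exact ih.radDiv hD hrefl

lemma SmoothEven.smul_radDiv (hD : IsOpen D) (hrefl : ReflInv p D) (hE : SmoothEven p D E)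
    {z : Sl p} (hz : z ∈ D) : z.2 • GPS.radDiv p E z = pdr p E z :=
  (hE.odd_pdr hD hrefl).smul_divR hz

end DivR

section Recursion

variable {p : ℕ} {G : Type*} [NormedAddCommGroup G] [NormedSpace ℝ G]
  {D : Set (Sl p)} {F E H : Sl p → G}

lemma differentiableAt_of_contDiffOn (hD : IsOpen D) (hF : ContDiffOn ℝ ∞ F D) {z : Sl p}
    (hz : z ∈ D) : DifferentiableAt ℝ F z :=
  (hF.contDiffAt (hD.mem_nhds hz)).differentiableAt (by simp)

lemma fderiv_snd_smul {z : Sl p} (hF : DifferentiableAt ℝ F z) (v : Sl p) :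
    fderiv ℝ (fun w : Sl p => w.2 • F w) z v = z.2 • fderiv ℝ F z v + v.2 • F z := by
  have h := (hasFDerivAt_snd (𝕜 := ℝ) (p := z)).fun_smul hF.hasFDerivAt
  rw [h.fderiv]
  simp

lemma contDiffOn_LapSl (hD : IsOpen D) (hF : ContDiffOn ℝ ∞ F D) :
    ContDiffOn ℝ ∞ (LapSl p F) D := by
  refine ContDiffOn.add (ContDiffOn.sum fun i _ => ?_) ?_
  · exact contDiffOn_fderiv_apply hD (contDiffOn_fderiv_apply hD hF _) _
  · exact contDiffOn_fderiv_apply hD (contDiffOn_fderiv_apply hD hF _) _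

lemma LapSl_congr (hD : IsOpen D) (h : ∀ z ∈ D, F z = H z) {z : Sl p} (hz : z ∈ D) :
    LapSl p F z = LapSl p H z := by
  have key : ∀ {F H : Sl p → G}, (∀ z ∈ D, F z = H z) → ∀ v : Sl p, ∀ z ∈ D,
      fderiv ℝ F z v = fderiv ℝ H z v := fun {F H} h v z hz => by
    have : F =ᶠ[𝓝 z] H := by filter_upwards [hD.mem_nhds hz] with w hw using h w hw
    rw [this.fderiv_eq]
  unfold LapSl
  congr 1
  · exact Finset.sum_congr rfl fun i _ => key (fun w hw => key h _ w hw) _ z hz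
  · exact key (fun w hw => key h _ w hw) _ z hz

lemma LapSl_snd_smul (hD : IsOpen D) (hF : ContDiffOn ℝ ∞ F D) {z : Sl p} (hz : z ∈ D) :
    LapSl p (fun w => w.2 • F w) z = z.2 • LapSl p F z + (2 : ℝ) • pdr p F z := by
  have hd : ∀ v, ContDiffOn ℝ ∞ (fun w => fderiv ℝ F w v) D := contDiffOn_fderiv_apply hD hF
  have h1 : ∀ i, pdSl p i (pdSl p i fun w => w.2 • F w) z = z.2 • pdSl p i (pdSl p i F) z := by
    intro i
    have e : pdSl p i (fun w => w.2 • F w) =ᶠ[𝓝 z] fun w => w.2 • pdSl p i F w := by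
      filter_upwards [hD.mem_nhds hz] with w hw
      simp [pdSl, fderiv_snd_smul (differentiableAt_of_contDiffOn hD hF hw)]
    have hdz : DifferentiableAt ℝ (pdSl p i F) z := differentiableAt_of_contDiffOn hD (hd _) hz
    change fderiv ℝ _ z _ = z.2 • fderiv ℝ _ z _
    rw [e.fderiv_eq, fderiv_snd_smul hdz]
    simp
  have h2 : pdr p (pdr p fun w => w.2 • F w) z
      = z.2 • pdr p (pdr p F) z + (2 : ℝ) • pdr p F z := by
    have e : pdr p (fun w => w.2 • F w) =ᶠ[𝓝 z] fun w => w.2 • pdr p F w + F w := by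
      filter_upwards [hD.mem_nhds hz] with w hw
      simp [pdr, fderiv_snd_smul (differentiableAt_of_contDiffOn hD hF hw)]
    have hdz : DifferentiableAt ℝ (pdr p F) z := differentiableAt_of_contDiffOn hD (hd _) hz
    change fderiv ℝ _ z _ = z.2 • fderiv ℝ _ z _ + _
    rw [e.fderiv_eq, fderiv_fun_add (by fun_prop) (differentiableAt_of_contDiffOn hD hF hz),
      add_apply, fderiv_snd_smul hdz, two_smul]
    simp [pdr, add_assoc]
  simp only [LapSl, h1, h2, ← Finset.smul_sum, smul_add, add_assoc]

lemma LapSl_pdr (hD : IsOpen D) (hF : ContDiffOn ℝ ∞ F D) {z : Sl p} (hz : z ∈ D) :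
    LapSl p (pdr p F) z = pdr p (LapSl p F) z := by
  have hd : ∀ v, ContDiffOn ℝ ∞ (fun w => fderiv ℝ F w v) D := contDiffOn_fderiv_apply hD hF
  have hdd : ∀ v u, DifferentiableAt ℝ (fun w => fderiv ℝ (fun w => fderiv ℝ F w v) w u) z :=
    fun v u => differentiableAt_of_contDiffOn hD (contDiffOn_fderiv_apply hD (hd v) u) hz
  have h : ∀ v : Sl p, fderiv ℝ (fun w => fderiv ℝ (pdr p F) w v) z v
      = fderiv ℝ (fun w => fderiv ℝ (fun w => fderiv ℝ F w v) w v) z (0, 1) := by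
    intro v
    rw [fderiv_fderiv_apply_comm hD (hd v) hz v (0, 1)]
    have e : (fun w => fderiv ℝ (pdr p F) w v)
        =ᶠ[𝓝 z] fun w => fderiv ℝ (fun w => fderiv ℝ F w v) w (0, 1) := by
      filter_upwards [hD.mem_nhds hz] with w hw using fderiv_fderiv_apply_comm hD hF hw _ _
    rw [e.fderiv_eq]
  have hR : pdr p (LapSl p F) z = ∑ i, fderiv ℝ (pdSl p i (pdSl p i F)) z (0, 1)
      + fderiv ℝ (pdr p (pdr p F)) z (0, 1) := by
    have hd1 : ∀ i, DifferentiableAt ℝ (pdSl p i (pdSl p i F)) z := fun i => hdd _ _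
    have hd2 : DifferentiableAt ℝ (pdr p (pdr p F)) z := hdd _ _
    change fderiv ℝ (fun z => ∑ i, pdSl p i (pdSl p i F) z + pdr p (pdr p F) z) z (0, 1) = _
    rw [fderiv_fun_add (DifferentiableAt.fun_sum fun i _ => hd1 i) hd2, add_apply,
      fderiv_fun_sum fun i _ => hd1 i, sum_apply]
  rw [hR]
  unfold LapSl
  congr 1
  exact Finset.sum_congr rfl fun i _ => h _

lemma eq_zero_of_snd_smul_eq_zero (hD : IsOpen D) (hF : ContinuousOn F D)
    (h : ∀ z ∈ D, z.2 • F z = 0) {z : Sl p} (hz : z ∈ D) : F z = 0 := by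
  by_cases h0 : z.2 = 0
  · have hc : Tendsto (fun t : ℝ => ((z.1, t) : Sl p)) (𝓝 0) (𝓝 z) := by
      have : Continuous fun t : ℝ => ((z.1, t) : Sl p) := by fun_prop
      have h := this.tendsto 0
      rwa [show ((z.1, (0 : ℝ)) : Sl p) = z from Prod.ext rfl h0.symm] at h
    have h1 : Tendsto (fun t : ℝ => F (z.1, t)) (𝓝[≠] 0) (𝓝 (F z)) :=
      ((hF.continuousAt (hD.mem_nhds hz)).tendsto.comp hc).mono_left nhdsWithin_le_nhds
    have h2 : Tendsto (fun t : ℝ => F (z.1, t)) (𝓝[≠] 0) (𝓝 0) := by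
      refine tendsto_const_nhds.congr' ?_
      filter_upwards [nhdsWithin_le_nhds (hc.eventually (hD.mem_nhds hz)),
        self_mem_nhdsWithin] with t ht ht0
      exact ((smul_eq_zero.1 (h _ ht)).resolve_left ht0).symm
    exact tendsto_nhds_unique h1 h2
  · exact (smul_eq_zero.1 (h z hz)).resolve_left h0

lemma SmoothEven.pdSl (hD : IsOpen D) (hrefl : ReflInv p D) (hE : SmoothEven p D E)
    (v : Vp p) : SmoothEven p D (fun z => fderiv ℝ E z (v, 0)) := by
  refine ⟨contDiffOn_fderiv_apply hD hE.smooth _, fun z hz => ?_⟩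
  have h1 : HasFDerivAt (fun w : Sl p => ((w.1, -w.2) : Sl p))
      ((ContinuousLinearMap.fst ℝ (Vp p) ℝ).prod (-ContinuousLinearMap.snd ℝ (Vp p) ℝ)) z :=
    hasFDerivAt_fst.prodMk hasFDerivAt_snd.neg
  have h2 := (differentiableAt_of_contDiffOn hD hE.smooth (hrefl z hz)).hasFDerivAt.comp z h1
  have h3 : (E ∘ fun w : Sl p => ((w.1, -w.2) : Sl p)) =ᶠ[𝓝 z] E := by
    filter_upwards [hD.mem_nhds hz] with w hw using hE.even w hw
  have h4 := h2.fderiv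
  rw [h3.fderiv_eq] at h4
  simp [h4]

variable [CompleteSpace G]

/-- If `E` solves the Euler–Poisson–Darboux equation `(Δ + c (1/r)∂_r) E = 0`, then
`(1/r)∂_r E` solves it with `c + 2` in place of `c`. -/
lemma SmoothEven.LapSl_radDiv (hD : IsOpen D) (hrefl : ReflInv p D) (hE : SmoothEven p D E)
    {c : ℝ} (h : ∀ z ∈ D, LapSl p E z + c • GPS.radDiv p E z = 0) {z : Sl p} (hz : z ∈ D) :
    LapSl p (GPS.radDiv p E) z + (c + 2) • GPS.radDiv p (GPS.radDiv p E) z = 0 := by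
  have hT := hE.radDiv hD hrefl
  have hTT := hT.radDiv hD hrefl
  refine eq_zero_of_snd_smul_eq_zero
    (F := fun z => LapSl p (GPS.radDiv p E) z + (c + 2) • GPS.radDiv p (GPS.radDiv p E) z) hD
    ((contDiffOn_LapSl hD hT.smooth).continuousOn.add
      (hTT.smooth.continuousOn.const_smul (c + 2))) (fun z hz => ?_) hz
  have e1 : LapSl p (pdr p E) z = -(c • pdr p (GPS.radDiv p E) z) := by
    rw [LapSl_pdr hD hE.smooth hz]
    have : LapSl p E =ᶠ[𝓝 z] fun w => -(c • GPS.radDiv p E w) := by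
      filter_upwards [hD.mem_nhds hz] with w hw using eq_neg_of_add_eq_zero_left (h w hw)
    unfold pdr
    rw [this.fderiv_eq, fderiv_fun_neg,
      fderiv_fun_const_smul (differentiableAt_of_contDiffOn hD hT.smooth hz)]
    rfl
  have e2 : LapSl p (pdr p E) z = z.2 • LapSl p (GPS.radDiv p E) z
      + (2 : ℝ) • pdr p (GPS.radDiv p E) z := by
    rw [← LapSl_snd_smul hD hT.smooth hz]
    exact LapSl_congr hD (fun w hw => (hE.smul_radDiv hD hrefl hw).symm) hz
  rw [smul_add, smul_comm, hT.smul_radDiv hD hrefl hz, add_smul]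
  have e3 := e2.symm.trans e1
  rw [add_comm (c • _), ← add_assoc, e3]
  simp

/-- If `r • E` is harmonic, then `(Δ + 2 (1/r)∂_r) E = 0`. -/
lemma SmoothEven.LapSl_of_snd_smul (hD : IsOpen D) (hrefl : ReflInv p D) (hE : SmoothEven p D E)
    (h : ∀ z ∈ D, LapSl p (fun w => w.2 • E w) z = 0) {z : Sl p} (hz : z ∈ D) :
    LapSl p E z + (2 : ℝ) • GPS.radDiv p E z = 0 := by
  have hT := hE.radDiv hD hrefl
  refine eq_zero_of_snd_smul_eq_zero
    (F := fun z => LapSl p E z + (2 : ℝ) • GPS.radDiv p E z) hD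
    ((contDiffOn_LapSl hD hE.smooth).continuousOn.add
      (hT.smooth.continuousOn.const_smul (2 : ℝ))) (fun z hz => ?_) hz
  rw [smul_add, smul_comm, hE.smul_radDiv hD hrefl hz, ← LapSl_snd_smul hD hE.smooth hz, h z hz]

lemma SmoothEven.iterate_LapSl (hD : IsOpen D) (hrefl : ReflInv p D) (hE : SmoothEven p D E)
    {c : ℝ} (h : ∀ z ∈ D, LapSl p E z + c • GPS.radDiv p E z = 0) (k : ℕ) :
    ∀ z ∈ D, LapSl p ((GPS.radDiv p)^[k] E) z
      + (c + 2 * k) • GPS.radDiv p ((GPS.radDiv p)^[k] E) z = 0 := by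
  induction k with
  | zero => simpa using h
  | succ k ih =>
    intro z hz
    have := (hE.iterate_radDiv hD hrefl k).LapSl_radDiv hD hrefl ih hz
    rw [Function.iterate_succ_apply']
    convert this using 3
    push_cast
    ring

/-- `∂_r² E = T E + r² T² E` with `T = (1/r)∂_r`. -/
lemma SmoothEven.pdr_pdr (hD : IsOpen D) (hrefl : ReflInv p D)
    (hE : SmoothEven p D E)
    {z : Sl p} (hz : z ∈ D) : GPS.pdr p (GPS.pdr p E) z
      = GPS.radDiv p E z + z.2 ^ 2 • GPS.radDiv p (GPS.radDiv p E) z := by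
  have hT := hE.radDiv hD hrefl
  have e : GPS.pdr p E =ᶠ[𝓝 z] fun w => w.2 • GPS.radDiv p E w := by
    filter_upwards [hD.mem_nhds hz] with w hw using (hE.smul_radDiv hD hrefl hw).symm
  have h := fderiv_snd_smul (differentiableAt_of_contDiffOn hD hT.smooth hz) (0, 1)
  rw [← e.fderiv_eq] at h
  have h2 := hT.smul_radDiv hD hrefl hz
  unfold GPS.pdr at h2 h ⊢
  rw [h, ← h2, smul_smul, pow_two, one_smul, add_comm]

end Recursion

section Lift

variable {p q : ℕ} {G : Type*} [NormedAddCommGroup G] [NormedSpace ℝ G]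
  {D : Set (Sl p)} {E : Sl p → G}

/-- The point `(𝐱_p, |𝐱_q|)` of the slice. -/
def absPt (y : V p q) : Sl p := (y.1, ‖y.2‖)

lemma continuous_absPt : Continuous (absPt : V p q → Sl p) := by
  unfold absPt
  fun_prop

lemma hasFDerivAt_norm_of_ne {y : Vq q} (hy : y ≠ 0) :
    HasFDerivAt (fun w : Vq q => ‖w‖) (‖y‖⁻¹ • innerSL ℝ y) y := by
  have h := (hasStrictFDerivAt_norm_sq y).hasFDerivAt.sqrt (by positivity)
  simp only [Real.sqrt_sq (norm_nonneg _)] at h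
  refine h.congr_fderiv (ContinuousLinearMap.ext fun w => ?_)
  have := norm_ne_zero_iff.2 hy
  simp
  field_simp

/-- The derivative of `(𝐱_p, 𝐱_q) ↦ E (𝐱_p, |𝐱_q|)`. -/
lemma SmoothEven.hasFDerivAt_lift [CompleteSpace G] (hD : IsOpen D) (hrefl : ReflInv p D)
    (hE : SmoothEven p D E) {y : V p q} (hy : absPt y ∈ D) :
    HasFDerivAt (fun y : V p q => E (absPt y))
      ((fderiv ℝ E (absPt y)).comp ((ContinuousLinearMap.inl ℝ (Vp p) ℝ).comp
          (ContinuousLinearMap.fst ℝ (Vp p) (Vq q)))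
        + ((innerSL ℝ y.2).comp (ContinuousLinearMap.snd ℝ (Vp p) (Vq q))).smulRight
          (GPS.radDiv p E (absPt y))) y := by
  have hEd := (differentiableAt_of_contDiffOn hD hE.smooth hy).hasFDerivAt
  have hsplit : ∀ (h : Vp p) (s : ℝ), fderiv ℝ E (absPt y) (h, s)
      = fderiv ℝ E (absPt y) (h, 0) + (s * ‖y.2‖) • GPS.radDiv p E (absPt y) := by
    intro h s
    have e : ((h, s) : Sl p) = (h, 0) + s • (0, 1) := by simp
    rw [e, map_add, map_smul, mul_smul]
    congr 2
    exact (hE.smul_radDiv hD hrefl hy).symm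
  by_cases h0 : y.2 = 0
  · rw [hasFDerivAt_iff_isLittleO] at hEd ⊢
    have h1 := hEd.comp_tendsto (continuous_absPt (p := p) (q := q)).continuousAt
    have h2 : (fun w : V p q => absPt w - absPt y) =O[𝓝 y] fun w => w - y := by
      refine Asymptotics.IsBigO.of_bound 1 (Eventually.of_forall fun w => ?_)
      rw [one_mul, Prod.norm_def, Prod.norm_def]
      exact max_le_max le_rfl (by simpa [absPt] using abs_norm_sub_norm_le w.2 y.2)
    refine (h1.trans_isBigO h2).congr_left fun w => ?_
    have h3 := hsplit (w.1 - y.1) (‖w.2‖ - ‖y.2‖)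
    have e : absPt w - absPt y = (w.1 - y.1, ‖w.2‖ - ‖y.2‖) := rfl
    simp only [Function.comp_apply, e, h3]
    simp [h0]
  · have h1 : HasFDerivAt (absPt : V p q → Sl p)
        ((ContinuousLinearMap.fst ℝ (Vp p) (Vq q)).prod
          ((‖y.2‖⁻¹ • innerSL ℝ y.2).comp (ContinuousLinearMap.snd ℝ (Vp p) (Vq q)))) y :=
      hasFDerivAt_fst.prodMk ((hasFDerivAt_norm_of_ne h0).comp y hasFDerivAt_snd)
    refine (hEd.comp y h1).congr_fderiv ?_
    refine ContinuousLinearMap.ext fun w => ?_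
    have h3 := hsplit w.1 (‖y.2‖⁻¹ * ⟪y.2, w.2⟫)
    have e : ‖y.2‖⁻¹ * ⟪y.2, w.2⟫ * ‖y.2‖ = ⟪y.2, w.2⟫ := by
      have := norm_ne_zero_iff.2 h0
      field_simp
    rw [e] at h3
    simpa using h3

end Lift

section Comb

variable {p q : ℕ} {A : Type*} [NormedRing A] [NormedAlgebra ℝ A] (ξ : A ≃ₐ[ℝ] Cl (p + q))
  {D : Set (Sl p)} {E G : Sl p → A}

/-- The map `ωCl` as a continuous linear map. -/
def ωLin : Vq q →L[ℝ] A := ∑ j, (EuclideanSpace.proj j : Vq q →L[ℝ] ℝ).smulRight (eQ p q ξ j)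

lemma ωLin_apply (v : Vq q) : ωLin ξ v = ωCl p q ξ v := by
  simp [ωLin, ωCl, sum_apply]

lemma ωCl_smul (c : ℝ) (v : Vq q) : ωCl p q ξ (c • v) = c • ωCl p q ξ v := by
  rw [← ωLin_apply, ← ωLin_apply, map_smul]

lemma ωCl_single (j : Fin q) : ωCl p q ξ (EuclideanSpace.single j 1) = eQ p q ξ j := by
  simp [ωCl, ite_smul]

/-- The function `E(𝐱_p, |𝐱_q|) + 𝐱_q G(𝐱_p, |𝐱_q|)`. -/
def comb (E G : Sl p → A) (y : V p q) : A := E (absPt y) + ωCl p q ξ y.2 * G (absPt y)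

variable [CompleteSpace A]

lemma differentiableAt_lift (hD : IsOpen D) (hrefl : ReflInv p D) (hE : SmoothEven p D E)
    {y : V p q} (hy : absPt y ∈ D) : DifferentiableAt ℝ (fun y : V p q => E (absPt y)) y :=
  (hE.hasFDerivAt_lift hD hrefl hy).differentiableAt

lemma fderiv_lift (hD : IsOpen D) (hrefl : ReflInv p D) (hE : SmoothEven p D E)
    {y : V p q} (hy : absPt y ∈ D) (w : V p q) :
    fderiv ℝ (fun y : V p q => E (absPt y)) y w
      = fderiv ℝ E (absPt y) (w.1, 0) + ⟪y.2, w.2⟫ • radDiv p E (absPt y) := by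
  rw [(hE.hasFDerivAt_lift hD hrefl hy).fderiv]
  simp

lemma hasFDerivAt_comb (hD : IsOpen D) (hrefl : ReflInv p D) (hE : SmoothEven p D E)
    (hG : SmoothEven p D G) {y : V p q} (hy : absPt y ∈ D) :
    DifferentiableAt ℝ (comb ξ E G) y ∧ ∀ w : V p q, fderiv ℝ (comb ξ E G) y w
      = comb ξ (fun z => fderiv ℝ E z (w.1, 0)) (fun z => fderiv ℝ G z (w.1, 0)) y
        + ⟪y.2, w.2⟫ • comb ξ (radDiv p E) (radDiv p G) y + ωCl p q ξ w.2 * G (absPt y) := by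
  have hω : HasFDerivAt (fun y : V p q => ωCl p q ξ y.2)
      ((ωLin ξ).comp (ContinuousLinearMap.snd ℝ (Vp p) (Vq q))) y := by
    have := (ωLin ξ).hasFDerivAt.comp y (hasFDerivAt_snd (𝕜 := ℝ) (p := y))
    exact this.congr_of_eventuallyEq (Eventually.of_forall fun y => (ωLin_apply ξ y.2).symm)
  have h := (differentiableAt_lift hD hrefl hE hy).hasFDerivAt.add
    (hω.mul' (differentiableAt_lift hD hrefl hG hy).hasFDerivAt)
  have h' : HasFDerivAt (comb ξ E G) _ y := h
  refine ⟨h'.differentiableAt, fun w => ?_⟩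
  rw [h'.fderiv]
  simp only [add_apply, smul_apply, ContinuousLinearMap.comp_apply,
    ContinuousLinearMap.coe_snd', ωLin_apply, fderiv_lift hD hrefl hE hy,
    fderiv_lift hD hrefl hG hy, smul_eq_mul, MulOpposite.smul_eq_mul_unop, MulOpposite.unop_op,
    comb, smul_add, mul_add, mul_smul_comm]
  abel

lemma pdV1_comb (hD : IsOpen D) (hrefl : ReflInv p D) (hE : SmoothEven p D E)
    (hG : SmoothEven p D G) (i : Fin (p + 1)) {y : V p q} (hy : absPt y ∈ D) :
    pdV1 p q i (comb ξ E G) y = comb ξ (pdSl p i E) (pdSl p i G) y := by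
  unfold pdV1
  rw [(hasFDerivAt_comb ξ hD hrefl hE hG hy).2]
  have : ωCl p q ξ 0 = 0 := by rw [← ωLin_apply, map_zero]
  simp [this]
  rfl

lemma pdV2_comb (hD : IsOpen D) (hrefl : ReflInv p D) (hE : SmoothEven p D E)
    (hG : SmoothEven p D G) (j : Fin q) {y : V p q} (hy : absPt y ∈ D) :
    pdV2 p q j (comb ξ E G) y
      = y.2 j • comb ξ (radDiv p E) (radDiv p G) y + eQ p q ξ j * G (absPt y) := by
  unfold pdV2
  rw [(hasFDerivAt_comb ξ hD hrefl hE hG hy).2, ωCl_single]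
  have h0 : ((0, 0) : Sl p) = 0 := rfl
  simp [comb, h0, EuclideanSpace.inner_single_right]

omit [CompleteSpace A] in
lemma eventually_absPt_mem (hD : IsOpen D) {y : V p q} (hy : absPt y ∈ D) :
    ∀ᶠ w in 𝓝 y, absPt w ∈ D :=
  continuous_absPt.continuousAt.eventually (hD.mem_nhds hy)

lemma pdV1_pdV1_comb (hD : IsOpen D) (hrefl : ReflInv p D) (hE : SmoothEven p D E)
    (hG : SmoothEven p D G) (i : Fin (p + 1)) {y : V p q} (hy : absPt y ∈ D) :
    pdV1 p q i (pdV1 p q i (comb ξ E G)) y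
      = comb ξ (pdSl p i (pdSl p i E)) (pdSl p i (pdSl p i G)) y := by
  have hE1 : SmoothEven p D (pdSl p i E) := hE.pdSl hD hrefl _
  have hG1 : SmoothEven p D (pdSl p i G) := hG.pdSl hD hrefl _
  rw [← pdV1_comb ξ hD hrefl hE1 hG1 i hy]
  have e : pdV1 p q i (comb ξ E G) =ᶠ[𝓝 y] comb ξ (pdSl p i E) (pdSl p i G) := by
    filter_upwards [eventually_absPt_mem hD hy] with w hw using pdV1_comb ξ hD hrefl hE hG i hw
  conv_lhs => unfold pdV1
  conv_rhs => unfold pdV1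
  exact congrArg (fun L : V p q →L[ℝ] A => L (Pi.single i 1, 0)) e.fderiv_eq

lemma pdV2_pdV2_comb (hD : IsOpen D) (hrefl : ReflInv p D) (hE : SmoothEven p D E)
    (hG : SmoothEven p D G) (j : Fin q) {y : V p q} (hy : absPt y ∈ D) :
    pdV2 p q j (pdV2 p q j (comb ξ E G)) y
      = comb ξ (radDiv p E) (radDiv p G) y
        + y.2 j ^ 2 • comb ξ (radDiv p (radDiv p E)) (radDiv p (radDiv p G)) y
        + (2 : ℝ) • (y.2 j • eQ p q ξ j * radDiv p G (absPt y)) := by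
  have hTE := hE.radDiv hD hrefl
  have hTG := hG.radDiv hD hrefl
  have e : pdV2 p q j (comb ξ E G) =ᶠ[𝓝 y] fun y =>
      y.2 j • comb ξ (radDiv p E) (radDiv p G) y + eQ p q ξ j * G (absPt y) := by
    filter_upwards [eventually_absPt_mem hD hy] with w hw using pdV2_comb ξ hD hrefl hE hG j hw
  have hproj : HasFDerivAt (fun y : V p q => y.2 j) ((EuclideanSpace.proj j : Vq q →L[ℝ] ℝ).comp
      (ContinuousLinearMap.snd ℝ (Vp p) (Vq q))) y :=
    ((EuclideanSpace.proj j : Vq q →L[ℝ] ℝ).comp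
      (ContinuousLinearMap.snd ℝ (Vp p) (Vq q))).hasFDerivAt
  have h := (hproj.fun_smul (hasFDerivAt_comb ξ hD hrefl hTE hTG hy).1.hasFDerivAt).fun_add
    ((differentiableAt_lift hD hrefl hG hy).hasFDerivAt.const_mul (eQ p q ξ j))
  have h2 := pdV2_comb ξ hD hrefl hTE hTG j hy
  have h3 := fderiv_lift hD hrefl hG hy ((0, EuclideanSpace.single j 1) : V p q)
  have h0 : ((0, 0) : Sl p) = 0 := rfl
  unfold pdV2 at h2 e ⊢
  rw [e.fderiv_eq, h.fderiv]
  simp only [add_apply, smul_apply, h2, h3]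
  simp [h0, EuclideanSpace.inner_single_right, smul_smul, pow_two]
  module

lemma LapV_comb (hD : IsOpen D) (hrefl : ReflInv p D) (hE : SmoothEven p D E)
    (hG : SmoothEven p D G) {c : ℝ} (hcE : ∀ z ∈ D, LapSl p E z + c • radDiv p E z = 0)
    (hcG : ∀ z ∈ D, LapSl p G z + (2 + c) • radDiv p G z = 0) {y : V p q} (hy : absPt y ∈ D) :
    LapV p q (comb ξ E G) y = ((q : ℝ) - 1 - c) • comb ξ (radDiv p E) (radDiv p G) y := by
  have hsum : ∑ j, y.2 j ^ 2 = ‖y.2‖ ^ 2 := by rw [EuclideanSpace.norm_sq_eq]; simp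
  have hω : ∑ j, y.2 j • eQ p q ξ j = ωCl p q ξ y.2 := rfl
  have hLE := hcE _ hy
  have hLG := hcG _ hy
  simp only [LapSl, hE.pdr_pdr hD hrefl hy, hG.pdr_pdr hD hrefl hy] at hLE hLG
  have hE' : ∑ i, pdSl p i (pdSl p i E) (absPt y) = -(1 + c) • radDiv p E (absPt y)
      - ‖y.2‖ ^ 2 • radDiv p (radDiv p E) (absPt y) := by
    rw [← sub_eq_zero, ← hLE]
    simp only [absPt]
    module
  have hG' : ∑ i, pdSl p i (pdSl p i G) (absPt y) = -(3 + c) • radDiv p G (absPt y)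
      - ‖y.2‖ ^ 2 • radDiv p (radDiv p G) (absPt y) := by
    rw [← sub_eq_zero, ← hLG]
    simp only [absPt]
    module
  simp only [LapV, pdV1_pdV1_comb ξ hD hrefl hE hG _ hy, pdV2_pdV2_comb ξ hD hrefl hE hG _ hy,
    Finset.sum_add_distrib, ← Finset.sum_smul, ← Finset.smul_sum, ← Finset.sum_mul, hsum, hω]
  simp only [comb, Finset.sum_add_distrib, ← Finset.mul_sum, hE', hG', Finset.sum_const,
    Finset.card_univ, Fintype.card_fin, ← Nat.cast_smul_eq_nsmul ℝ, mul_sub, mul_smul_comm]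
  module

omit [CompleteSpace A] in
lemma LapV_congr {Ω : Set (V p q)} (hΩ : IsOpen Ω) {f g : V p q → A} (h : ∀ y ∈ Ω, f y = g y) :
    ∀ y ∈ Ω, LapV p q f y = LapV p q g y := by
  have key : ∀ {f g : V p q → A}, (∀ y ∈ Ω, f y = g y) → ∀ v : V p q, ∀ y ∈ Ω,
      fderiv ℝ f y v = fderiv ℝ g y v := fun {f g} h v y hy => by
    have : f =ᶠ[𝓝 y] g := by filter_upwards [hΩ.mem_nhds hy] with w hw using h w hw
    rw [this.fderiv_eq]
  intro y hy
  unfold LapV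
  congr 1
  · exact Finset.sum_congr rfl fun i _ => key (fun w hw => key h _ w hw) _ y hy
  · exact Finset.sum_congr rfl fun i _ => key (fun w hw => key h _ w hw) _ y hy

omit [CompleteSpace A] in
lemma LapV_const_smul (c : ℝ) (f : V p q → A) (y : V p q) :
    LapV p q (fun y => c • f y) y = c • LapV p q f y := by
  have key : ∀ (g : V p q → A) (v : V p q), (fun y => fderiv ℝ (fun y => c • g y) y v)
      = fun y => c • fderiv ℝ g y v := fun g v => by
    ext y
    change fderiv ℝ (c • g) y v = _
    rw [fderiv_const_smul_field]
    rfl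
  have key1 : ∀ (i : Fin (p + 1)) (g : V p q → A),
      pdV1 p q i (fun y => c • g y) = fun y => c • pdV1 p q i g y := fun i g => key g _
  have key2 : ∀ (j : Fin q) (g : V p q → A),
      pdV2 p q j (fun y => c • g y) = fun y => c • pdV2 p q j g y := fun j g => key g _
  simp only [LapV, key1, key2, smul_add, Finset.smul_sum]

lemma iterate_LapV_comb (hD : IsOpen D) (hrefl : ReflInv p D) (hE : SmoothEven p D E)
    (hG : SmoothEven p D G) (hcE : ∀ z ∈ D, LapSl p E z = 0)
    (hcG : ∀ z ∈ D, LapSl p G z + (2 : ℝ) • radDiv p G z = 0) {f : V p q → A}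
    (hf : ∀ y : V p q, absPt y ∈ D → f y = comb ξ E G y) (k : ℕ) :
    ∀ y : V p q, absPt y ∈ D → (LapV p q)^[k] f y
      = Cq q k • comb ξ ((radDiv p)^[k] E) ((radDiv p)^[k] G) y := by
  induction k with
  | zero => simpa [Cq] using hf
  | succ k ih =>
    have hC : Cq q (k + 1) = Cq q k * ((q : ℝ) - (2 * (k : ℝ) + 1)) := Finset.prod_range_succ _ _
    intro y hy
    rw [Function.iterate_succ_apply', Function.iterate_succ_apply', Function.iterate_succ_apply',
      LapV_congr (hD.preimage continuous_absPt) ih y hy, LapV_const_smul,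
      LapV_comb ξ hD hrefl (hE.iterate_radDiv hD hrefl k) (hG.iterate_radDiv hD hrefl k)
        (c := 2 * k) ?_ ?_ hy, smul_smul, hC]
    · congr 2
      ring
    · simpa using hE.iterate_LapSl hD hrefl (c := 0) (by simpa using hcE) k
    · exact hG.iterate_LapSl hD hrefl hcG k

end Comb

section Iterates

variable {p q : ℕ} {A : Type*} [NormedRing A] [NormedAlgebra ℝ A] (ξ : A ≃ₐ[ℝ] Cl (p + q))
  {D : Set (Sl p)} {f : V p q → A} {F1 F2 : Sl p → A}

lemma AIter_eq (F : Sl p → A) (k : ℕ) {z : Sl p} (hz : z.2 ≠ 0) :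
    AIter p F k z = (radDiv p)^[k] F z := by
  induction k generalizing z with
  | zero => rfl
  | succ k ih =>
    have e : AIter p F k =ᶠ[𝓝 z] (radDiv p)^[k] F := by
      filter_upwards [continuous_snd.continuousAt.eventually_ne hz] with w hw using ih hw
    rw [Function.iterate_succ_apply', radDiv, divR_of_ne hz]
    simp only [AIter, pdr, e.fderiv_eq]

lemma BIter_eq [CompleteSpace A] (hD : IsOpen D) (hrefl : ReflInv p D) {F G : Sl p → A}
    (hG : SmoothEven p D G) (hF : ∀ z ∈ D, z.2 • G z = F z) (k : ℕ) {z : Sl p} (hzD : z ∈ D)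
    (hz : z.2 ≠ 0) : BIter p F k z = z.2 • (radDiv p)^[k] G z := by
  induction k generalizing z with
  | zero => exact (hF z hzD).symm
  | succ k ih =>
    have e : (fun w : Sl p => w.2⁻¹ • BIter p F k w) =ᶠ[𝓝 z] (radDiv p)^[k] G := by
      filter_upwards [continuous_snd.continuousAt.eventually_ne hz, hD.mem_nhds hzD] with w hw hwD
      rw [ih hwD hw, inv_smul_smul₀ hw]
    rw [Function.iterate_succ_apply', (hG.iterate_radDiv hD hrefl k).smul_radDiv hD hrefl hzD]
    simp only [BIter, pdr, e.fderiv_eq]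

lemma norm_eq_one_of_mem_S {v : Vq q} (hv : v ∈ S q) : ‖v‖ = 1 := by
  have h : ∑ j, v j ^ 2 = 1 := hv
  have h2 : ‖v‖ ^ 2 = 1 := by rw [EuclideanSpace.norm_sq_eq]; simpa using h
  exact (pow_eq_one_iff_of_nonneg (norm_nonneg v) two_ne_zero).1 h2

lemma exists_mem_S_smul_eq (hq : 1 ≤ q) (y : Vq q) : ∃ v ∈ S q, ‖y‖ • v = y := by
  have hS : ∀ v : Vq q, ‖v‖ = 1 → v ∈ S q := fun v hv => by
    have h := EuclideanSpace.norm_sq_eq v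
    rw [hv] at h
    simpa [S] using h.symm
  by_cases hy : y = 0
  · exact ⟨EuclideanSpace.single ⟨0, hq⟩ 1, hS _ (by simp), by simp [hy]⟩
  · have := norm_ne_zero_iff.2 hy
    exact ⟨‖y‖⁻¹ • y, hS _ (by rw [norm_smul, norm_inv, norm_norm, inv_mul_cancel₀ this]),
      smul_inv_smul₀ this y⟩

lemma IsGPSlice.eq_comb (hq : 1 ≤ q) (hf : IsGPSlice p q ξ D f F1 F2) {G : Sl p → A}
    (hG : ∀ z ∈ D, z.2 • G z = F2 z) {y : V p q} (hy : absPt y ∈ D) :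
    f y = comb ξ F1 G y := by
  obtain ⟨v, hv, hvy⟩ := exists_mem_S_smul_eq hq y.2
  have h := hf.2 _ hy v hv
  have e : spt p q v (absPt y) = y := Prod.ext rfl hvy
  rw [e, ← hG _ hy] at h
  have hω : ωCl p q ξ y.2 = ‖y.2‖ • ωCl p q ξ v := by rw [← ωCl_smul, hvy]
  rw [h, comb, hω, smul_mul_assoc, mul_smul_comm]
  rfl

lemma comb_spt (hrefl : ReflInv p D) {E G : Sl p → A} (hE : EvenOn p D E) (hG : EvenOn p D G)
    {z : Sl p} (hz : z ∈ D) {v : Vq q} (hv : v ∈ S q) :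
    absPt (spt p q v z) ∈ D ∧ comb ξ E G (spt p q v z) = E z + ωCl p q ξ v * (z.2 • G z) := by
  have hn : absPt (spt p q v z) = (z.1, |z.2|) := by
    simp [absPt, spt, norm_smul, norm_eq_one_of_mem_S hv]
  rw [comb, hn, show (spt p q v z).2 = z.2 • v from rfl, ωCl_smul, smul_mul_assoc, mul_smul_comm]
  rcases abs_choice z.2 with h | h <;> rw [h]
  · exact ⟨hz, rfl⟩
  · exact ⟨hrefl z hz, by rw [hE z hz, hG z hz]⟩

omit [NormedAlgebra ℝ A] in
lemma tendsto_of_eq_of_ne (hD : IsOpen D) {F H : Sl p → A} (hH : ContinuousOn H D)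
    (h : ∀ z ∈ D, z.2 ≠ 0 → F z = H z) {x : Vp p} (hx : ((x, 0) : Sl p) ∈ D) :
    Tendsto (fun t : ℝ => F (x, t)) (𝓝[≠] 0) (𝓝 (H (x, 0))) := by
  have hc : Tendsto (fun t : ℝ => ((x, t) : Sl p)) (𝓝[≠] 0) (𝓝 (x, 0)) :=
    (Continuous.prodMk_right x).continuousAt.mono_left nhdsWithin_le_nhds
  refine ((hH.continuousAt (hD.mem_nhds hx)).tendsto.comp hc).congr' ?_
  filter_upwards [hc (hD.mem_nhds hx), self_mem_nhdsWithin] with t ht h0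
  exact (h _ ht h0).symm

end Iterates

end GPS

/-- Lemma 3.8.  For `f = F₁ + ωF₂ ∈ 𝒢𝒮ℛ(Ω_D)` and every `k ≥ 1`,
`Δ_𝐱^k f = C_q(k)(((1/r)∂_r)^k F₁ + ω (∂_r(1/r))^k F₂)` on `Ω_D`, where
`C_q(k) = (q−1)(q−3)⋯(q−2k+1)` and the values of the iterated operators at points
with `r = 0` are the limits as `r → 0`, which exist. -/
theorem iterated_laplacian_formula
    (p q : ℕ) (hq : 1 ≤ q) {A : Type*} [NormedRing A] [NormedAlgebra ℝ A]
    (ξ : A ≃ₐ[ℝ] Cl (p + q))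
    (D : Set (Sl p)) (hD : IsDomain D) (hrefl : ReflInv p D)
    (f : V p q → A) (F1 F2 : Sl p → A)
    (hgsr : GSROnWith p q ξ D f F1 F2) :
    ∀ k : ℕ, 1 ≤ k →
      ∃ Ak Bk : Sl p → A,
        (∀ z ∈ D, z.2 ≠ 0 → Ak z = AIter p F1 k z ∧ Bk z = BIter p F2 k z) ∧
        (∀ x : Vp p, ((x, 0) : Sl p) ∈ D →
          Tendsto (fun t : ℝ => AIter p F1 k (x, t)) (𝓝[≠] 0) (𝓝 (Ak (x, 0))) ∧
          Tendsto (fun t : ℝ => BIter p F2 k (x, t)) (𝓝[≠] 0) (𝓝 (Bk (x, 0)))) ∧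
        ∀ z ∈ D, ∀ v ∈ S q,
          (LapV p q)^[k] f (spt p q v z) = Cq q k • (Ak z + ωCl p q ξ v * Bk z) := by
  intro k _
  have hDo : IsOpen D := hD.1
  have : CompleteSpace A := completeSpace_of_equiv_Cl p q ξ
  obtain ⟨hslice, hF1, hF2, hCR⟩ := hgsr
  obtain ⟨hF1s, hF2s⟩ := contDiffOn_of_CRSystem p q ξ hDo hF1 hF2 hCR
  have hE : SmoothEven p D F1 := ⟨hF1s, fun z hz => (hslice.1 z hz).1⟩
  have hodd : OddOn p D F2 := fun z hz => (hslice.1 z hz).2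
  have hG : SmoothEven p D (divR p F2) := ⟨hodd.contDiffOn_divR hDo hF2s, hodd.divR⟩
  have hGF : ∀ z ∈ D, z.2 • divR p F2 z = F2 z := fun z hz => hodd.smul_divR hz
  have hL : ∀ z ∈ D, LapSl p F1 z = 0 ∧ LapSl p F2 z = 0 := fun z hz =>
    LapSl_eq_zero_of_CRSystem p q ξ hDo hF1s hF2s hCR hz
  have hLG : ∀ z ∈ D, LapSl p (divR p F2) z + (2 : ℝ) • radDiv p (divR p F2) z = 0 :=
    fun z hz => hG.LapSl_of_snd_smul hDo hrefl
      (fun w hw => (LapSl_congr hDo hGF hw).trans (hL w hw).2) hz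
  have hEk := hE.iterate_radDiv hDo hrefl k
  have hGk := hG.iterate_radDiv hDo hrefl k
  refine ⟨(radDiv p)^[k] F1, fun z => z.2 • (radDiv p)^[k] (divR p F2) z,
    fun z hz h0 => ⟨(AIter_eq F1 k h0).symm, (BIter_eq hDo hrefl hG hGF k hz h0).symm⟩,
    fun x hx => ⟨tendsto_of_eq_of_ne hDo hEk.smooth.continuousOn
        (fun z _ h0 => AIter_eq F1 k h0) hx,
      tendsto_of_eq_of_ne hDo (continuous_snd.continuousOn.smul hGk.smooth.continuousOn)
        (fun z hz h0 => BIter_eq hDo hrefl hG hGF k hz h0) hx⟩,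
    fun z hz v hv => ?_⟩
  obtain ⟨hmem, hcomb⟩ := comb_spt ξ hrefl hEk.even hGk.even hz hv
  rw [iterate_LapV_comb ξ hDo hrefl hE hG (fun z hz => (hL z hz).1) hLG
    (fun y hy => hslice.eq_comb ξ hq hGF hy) k _ hmem, hcomb]
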